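/- arXiv:2401.06029 — 3 statements merged into one kernel-verified Lean document; each statement's English description precedes it below -/
import Mathlib

section
/- Let G be an r-graph (r ≥ 1) and let E_1, …, E_n be the color classes of an edge-coloring of G. If for every subset I ⊆ {1,…,n} there exists a fractional matching x on the edge family ∪_{i∈I} E_i with Σ_e x(e) > r(|I| − 1), then G has a full rainbow matching with respect to E_1, …, E_n. -/
open Finset

/-- The degree of a vertex `v` in the multi-hypergraph with edge family `E`
(edges indexed by `ι`, parallel edges counted as distinct). -/
def mhDeg {V ι : Type} [Fintype ι] [DecidableEq V] (E : ι → Finset V) (v : V) : ℕ :=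
  (Finset.univ.filter fun a => v ∈ E a).card

/-- The size of the color class of color `i` under the edge-coloring `c`. -/
def classSize {ι κ : Type} [Fintype ι] [DecidableEq κ] (c : ι → κ) (i : κ) : ℕ :=
  (Finset.univ.filter fun a => c a = i).card

/-- An edge-coloring is proper if each color class is a matching. -/
def properColoring {V ι κ : Type} (E : ι → Finset V) (c : ι → κ) : Prop :=
  ∀ a b : ι, a ≠ b → c a = c b → Disjoint (E a) (E b)

/-- A full rainbow matching with respect to the coloring `c`: a set of pairwise disjoint
edges containing exactly one edge from each color class. -/
def hasFullRainbowMatching {V ι κ : Type} (E : ι → Finset V) (c : ι → κ) : Prop :=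
  ∃ f : κ → ι, (∀ i, c (f i) = i) ∧ ∀ i j : κ, i ≠ j → Disjoint (E (f i)) (E (f j))

section QuadraticForm

variable {V ι : Type} [DecidableEq V]

/-- The indicator, with real values, of two edges meeting. -/
def meets (E : ι → Finset V) (u v : ι) : ℝ := if Disjoint (E u) (E v) then 0 else 1

lemma meets_comm (E : ι → Finset V) (u v : ι) : meets E u v = meets E v u := by
  simp only [meets, disjoint_comm]

lemma meets_nonneg (E : ι → Finset V) (u v : ι) : 0 ≤ meets E u v := by
  unfold meets; split_ifs <;> norm_num

lemma meets_le_card_inter (E : ι → Finset V) (u v : ι) :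
    meets E u v ≤ ((E u ∩ E v).card : ℝ) := by
  unfold meets
  split_ifs with h
  · positivity
  · rw [Finset.disjoint_iff_inter_eq_empty, ← Finset.card_eq_zero] at h
    exact_mod_cast Nat.one_le_iff_ne_zero.mpr h

lemma card_inter_eq_sum (E : ι → Finset V) (u v : ι) :
    ((E u ∩ E v).card : ℝ) =
      ∑ p ∈ E u, if p ∈ E v then (1 : ℝ) else 0 := by
  rw [Finset.sum_boole, Finset.filter_mem_eq_inter]

lemma card_inter_eq_sum_biUnion [Fintype ι] (E : ι → Finset V) (u v : ι) :
    ((E u ∩ E v).card : ℝ) =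
      ∑ p ∈ univ.biUnion E, (if p ∈ E u then (1 : ℝ) else 0) * (if p ∈ E v then (1 : ℝ) else 0) := by
  have h : E u ∩ E v = (univ.biUnion E).filter fun p => p ∈ E u ∧ p ∈ E v := by
    ext p
    simp only [mem_inter, mem_filter, mem_biUnion, mem_univ, true_and]
    exact ⟨fun h => ⟨⟨u, h.1⟩, h⟩, fun h => h.2⟩
  rw [h, ← Finset.sum_boole]
  refine Finset.sum_congr rfl fun p _ => ?_
  by_cases h1 : p ∈ E u <;> by_cases h2 : p ∈ E v <;> simp [h1, h2]

lemma sum_card_inter_mul_nonneg [Fintype ι] (E : ι → Finset V) (h : ι → ℝ) :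
    0 ≤ ∑ u, ∑ v, ((E u ∩ E v).card : ℝ) * (h u * h v) := by
  have : ∑ u, ∑ v, ((E u ∩ E v).card : ℝ) * (h u * h v) =
      ∑ p ∈ univ.biUnion E, (∑ u, (if p ∈ E u then (1 : ℝ) else 0) * h u) ^ 2 := by
    simp only [sq, Finset.sum_mul_sum]
    rw [Finset.sum_comm (s := univ.biUnion E)]
    refine Finset.sum_congr rfl fun u _ => ?_
    rw [Finset.sum_comm (s := univ.biUnion E)]
    simp only [card_inter_eq_sum_biUnion, Finset.sum_mul]
    exact Finset.sum_congr rfl fun v _ => Finset.sum_congr rfl fun p _ => by ring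
  rw [this]
  positivity

lemma sum_card_inter_mul_le [Fintype ι] {r : ℕ} {E : ι → Finset V} (hcard : ∀ a, (E a).card = r) {x : ι → ℝ}
    (hfm : ∀ v : V, ∑ a ∈ univ.filter (fun a => v ∈ E a), x a ≤ 1) (u : ι) :
    ∑ v, ((E u ∩ E v).card : ℝ) * x v ≤ r := by
  simp only [card_inter_eq_sum, Finset.sum_mul]
  rw [Finset.sum_comm]
  calc _ ≤ ∑ p ∈ E u, (1 : ℝ) := Finset.sum_le_sum fun p _ => by
        simpa [Finset.sum_filter] using hfm p
    _ = r := by simp [hcard]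

/-- The quadratic form of the intersection relation on the edges of an `r`-graph, weighted by a
fractional matching, is bounded below. -/
lemma neg_sum_meets_le [Fintype ι] {r : ℕ} {E : ι → Finset V} (hcard : ∀ a, (E a).card = r) {x : ι → ℝ}
    (hx : ∀ a, 0 ≤ x a) (hfm : ∀ v : V, ∑ a ∈ univ.filter (fun a => v ∈ E a), x a ≤ 1)
    (g : ι → ℝ) :
    -∑ u, ∑ v, meets E u v * (x u * x v * (g u * g v)) ≤
      ∑ u, x u * g u ^ 2 * (r - ∑ v, meets E u v * x v) := by
  set q : ι → ι → ℝ := fun u v => ((E u ∩ E v).card : ℝ) with hq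
  have hqs : ∀ u v, q u v = q v u := fun u v => by simp only [hq, Finset.inter_comm]
  have h1 : ∀ u v, -(meets E u v * (x u * x v * (g u * g v))) ≤
      -(q u v * ((x u * g u) * (x v * g v))) +
        ((q u v - meets E u v) * (x u * x v * g u ^ 2) / 2 +
          (q v u - meets E v u) * (x v * x u * g v ^ 2) / 2) := by
    intro u v
    rw [hqs v u, meets_comm E v u]
    have := mul_nonneg (mul_nonneg (sub_nonneg.2 (meets_le_card_inter E u v))
      (mul_nonneg (hx u) (hx v))) (sq_nonneg (g u - g v))
    simp only [hq]
    nlinarith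
  have h2 := Finset.sum_le_sum fun u (_ : u ∈ univ) =>
    Finset.sum_le_sum fun v (_ : v ∈ univ) => h1 u v
  simp only [Finset.sum_add_distrib, Finset.sum_neg_distrib] at h2
  rw [Finset.sum_comm (f := fun u v => (q v u - meets E v u) * (x v * x u * g v ^ 2) / 2)] at h2
  have h3 := sum_card_inter_mul_nonneg E fun u => x u * g u
  have h4 : ∑ u, ∑ v, (q u v - meets E u v) * (x u * x v * g u ^ 2) / 2 ≤
      (∑ u, x u * g u ^ 2 * (r - ∑ v, meets E u v * x v)) / 2 := by
    rw [Finset.sum_div]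
    refine Finset.sum_le_sum fun u _ => ?_
    have h5 : ∑ v, (q u v - meets E u v) * (x u * x v * g u ^ 2) / 2 =
        x u * g u ^ 2 * (∑ v, q u v * x v - ∑ v, meets E u v * x v) / 2 := by
      rw [← Finset.sum_sub_distrib, Finset.mul_sum, Finset.sum_div]
      exact Finset.sum_congr rfl fun v _ => by ring
    rw [h5]
    have := sum_card_inter_mul_le hcard hfm u
    have h6 : 0 ≤ x u * g u ^ 2 := mul_nonneg (hx u) (sq_nonneg _)
    gcongr
  linarith

end QuadraticForm

section Chains

variable {V ι : Type}

/-- Tuples of pairwise disjoint edges, all of them in the edge set `P`. -/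
def IsMatchingTuple (E : ι → Finset V) (P : ι → Prop) {k : ℕ} (σ : Fin k → ι) : Prop :=
  (∀ i, P (σ i)) ∧ ∀ i j, i ≠ j → Disjoint (E (σ i)) (E (σ j))

/-- Simplicial chains with `k` vertices of the complex of matchings contained in `P`, viewed as
alternating functions on ordered tuples. -/
def matchingChains (E : ι → Finset V) (P : ι → Prop) (k : ℕ) :
    Submodule ℝ ((Fin k → ι) → ℝ) where
  carrier := {f | (∀ σ i j, i ≠ j → f (σ ∘ Equiv.swap i j) = -f σ) ∧
    ∀ σ, ¬ IsMatchingTuple E P σ → f σ = 0}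
  add_mem' := by
    rintro f g ⟨hf, hf'⟩ ⟨hg, hg'⟩
    refine ⟨fun σ i j h => ?_, fun σ h => ?_⟩
    · simp only [Pi.add_apply, hf σ i j h, hg σ i j h]; ring
    · simp [hf' σ h, hg' σ h]
  zero_mem' := by simp
  smul_mem' := by
    rintro a f ⟨hf, hf'⟩
    refine ⟨fun σ i j h => ?_, fun σ h => ?_⟩
    · simp [hf σ i j h]
    · simp [hf' σ h]

/-- Cycles, with the condition stated at all coordinates so that it is void for `k = 0`. -/
def tupleCycles (ι : Type) [Fintype ι] (k : ℕ) : Submodule ℝ ((Fin k → ι) → ℝ) where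
  carrier := {f | ∀ σ j, ∑ v, f (Function.update σ j v) = 0}
  add_mem' := by
    intro f g hf hg σ j
    simp [Finset.sum_add_distrib, hf σ j, hg σ j]
  zero_mem' := by simp
  smul_mem' := by
    intro a f hf σ j
    simp [← Finset.mul_sum, hf σ j]

/-- The boundary operator. -/
def tupleBoundary (ι : Type) [Fintype ι] (k : ℕ) :
    ((Fin (k + 1) → ι) → ℝ) →ₗ[ℝ] ((Fin k → ι) → ℝ) where
  toFun f τ := ∑ v, f (Fin.cons v τ)
  map_add' f g := by ext τ; simp [Finset.sum_add_distrib]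
  map_smul' a f := by ext τ; simp [Finset.mul_sum]

lemma tupleBoundary_apply [Fintype ι] {k : ℕ} (f : (Fin (k + 1) → ι) → ℝ) (τ : Fin k → ι) :
    tupleBoundary ι k f τ = ∑ v, f (Fin.cons v τ) := rfl

lemma cons_update_comp_swap {k : ℕ} (σ : Fin k → ι) (j : Fin k) (u v : ι) :
    (Fin.cons v (Function.update σ j u) : Fin (k + 1) → ι) ∘ Equiv.swap 0 j.succ =
      Fin.cons u (Function.update σ j v) := by
  funext i
  refine Fin.cases ?_ (fun i => ?_) i
  · simp
  · by_cases h : i = j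
    · subst h; simp [Function.update_of_ne (Fin.succ_ne_zero i).symm]
    · rw [Function.comp_apply, Equiv.swap_apply_of_ne_of_ne (Fin.succ_ne_zero i)
        (fun h' => h (Fin.succ_injective _ h'))]
      simp [h]

lemma cons_comp_swap_succ {k : ℕ} (σ : Fin k → ι) (i j : Fin k) (v : ι) :
    (Fin.cons v σ : Fin (k + 1) → ι) ∘ Equiv.swap i.succ j.succ =
      Fin.cons v (σ ∘ Equiv.swap i j) := by
  funext l
  refine Fin.cases ?_ (fun l => ?_) l
  · rw [Function.comp_apply, Equiv.swap_apply_of_ne_of_ne (Fin.succ_ne_zero i).symm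
      (Fin.succ_ne_zero j).symm]
    simp
  · simp only [Function.comp_apply, Fin.cons_succ]
    rw [← (Fin.succ_injective k).map_swap i j l, Fin.cons_succ]

lemma tupleBoundary_mem_tupleCycles [Fintype ι] {E : ι → Finset V} {P : ι → Prop} {k : ℕ}
    {f : (Fin (k + 1) → ι) → ℝ} (hf : f ∈ matchingChains E P (k + 1)) :
    tupleBoundary ι k f ∈ tupleCycles ι k := by
  intro σ j
  simp only [tupleBoundary_apply]
  have h : ∑ u, ∑ v, f (Fin.cons v (Function.update σ j u)) =
      ∑ u, ∑ v, -f (Fin.cons u (Function.update σ j v)) := by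
    refine Finset.sum_congr rfl fun u _ => Finset.sum_congr rfl fun v _ => ?_
    rw [← hf.1 _ 0 j.succ (Fin.succ_ne_zero j).symm, cons_update_comp_swap]
  have h' := Finset.sum_comm (s := univ) (t := univ)
    (f := fun u v => f (Fin.cons u (Function.update σ j v)))
  simp only [Finset.sum_neg_distrib] at h
  linarith

lemma isMatchingTuple_cons {E : ι → Finset V} {P : ι → Prop} {k : ℕ} {v : ι} {τ : Fin k → ι} :
    IsMatchingTuple E P (Fin.cons v τ : Fin (k + 1) → ι) ↔
      P v ∧ (∀ i, Disjoint (E v) (E (τ i))) ∧ IsMatchingTuple E P τ := by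
  constructor
  · rintro ⟨h1, h2⟩
    refine ⟨h1 0, fun i => h2 0 i.succ (Fin.succ_ne_zero i).symm, fun i => h1 i.succ,
      fun i j hij => h2 i.succ j.succ fun h => hij (Fin.succ_injective _ h)⟩
  · rintro ⟨h1, h2, h3, h4⟩
    refine ⟨Fin.cases h1 h3, Fin.cases (Fin.cases (fun h => absurd rfl h) fun j _ => h2 j)
      fun i => Fin.cases (fun _ => (h2 i).symm) fun j h => h4 i j fun h' => h (by rw [h'])⟩

lemma isMatchingTuple_comp_swap {E : ι → Finset V} {P : ι → Prop} {k : ℕ} {σ : Fin k → ι}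
    (i j : Fin k) : IsMatchingTuple E P (σ ∘ Equiv.swap i j) ↔ IsMatchingTuple E P σ := by
  have key : ∀ σ : Fin k → ι, IsMatchingTuple E P σ → IsMatchingTuple E P (σ ∘ Equiv.swap i j) :=
    fun σ h => ⟨fun l => h.1 _, fun l m hlm => h.2 _ _ ((Equiv.swap i j).injective.ne hlm)⟩
  refine ⟨fun h => ?_, key σ⟩
  have := key _ h
  rwa [Function.comp_assoc, ← Equiv.coe_trans, Equiv.swap_swap] at this

lemma tupleBoundary_mem_matchingChains [Fintype ι] {E : ι → Finset V} {P : ι → Prop} {k : ℕ}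
    {f : (Fin (k + 1) → ι) → ℝ} (hf : f ∈ matchingChains E P (k + 1)) :
    tupleBoundary ι k f ∈ matchingChains E P k := by
  refine ⟨fun σ i j hij => ?_, fun σ h => ?_⟩
  · simp only [tupleBoundary_apply, ← Finset.sum_neg_distrib]
    refine Finset.sum_congr rfl fun v _ => ?_
    rw [← hf.1 _ i.succ j.succ fun h => hij (Fin.succ_injective _ h), cons_comp_swap_succ]
  · exact Finset.sum_eq_zero fun v _ => hf.2 _ fun h' => h (isMatchingTuple_cons.1 h').2.2

lemma mem_tupleCycles_of_tupleBoundary_eq_zero [Fintype ι] {E : ι → Finset V} {P : ι → Prop} {k : ℕ}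
    {f : (Fin (k + 1) → ι) → ℝ} (hf : f ∈ matchingChains E P (k + 1))
    (h0 : tupleBoundary ι k f = 0) : f ∈ tupleCycles ι (k + 1) := by
  intro σ j
  have hu : ∀ (σ : Fin (k + 1) → ι) v, Function.update σ 0 v = Fin.cons v (Fin.tail σ) := by
    intro σ v
    rw [← Fin.update_cons_zero (σ 0) (Fin.tail σ) v, Fin.cons_self_tail]
  by_cases hj : j = 0
  · subst hj
    simp only [hu]
    exact congrFun h0 (Fin.tail σ)
  · have h : ∀ v, f (Function.update σ j v) =
        -f (Fin.cons v (Fin.tail (σ ∘ Equiv.swap 0 j))) := by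
      intro v
      rw [← hf.1 _ 0 j (Ne.symm hj), ← hu]
      congr 1
      funext i
      by_cases hi : i = j
      · subst hi; simp
      · by_cases hi0 : i = 0
        · subst hi0; simp [Function.update_of_ne hi, Function.update_of_ne (Ne.symm hi)]
        · simp [hi, hi0, Equiv.swap_apply_of_ne_of_ne hi0 hi]
    simp only [h, Finset.sum_neg_distrib, neg_eq_zero]
    exact congrFun h0 _

/-- Unnormalized coboundary, with the signs absorbed in the order of the entries. -/
def tupleCoboundary {k : ℕ} (φ : (Fin k → ι) → ℝ) (s : Fin (k + 1) → ι) : ℝ :=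
  φ (Fin.tail s) - ∑ j, φ (Function.update (Fin.tail s) j (s 0))

lemma tupleCoboundary_comp_swap [Fintype ι] {k : ℕ} {φ : (Fin k → ι) → ℝ}
    (hφ : ∀ σ i j, i ≠ j → φ (σ ∘ Equiv.swap i j) = -φ σ) (s : Fin (k + 1) → ι)
    (a b : Fin (k + 1)) (hab : a ≠ b) :
    tupleCoboundary φ (s ∘ Equiv.swap a b) = -tupleCoboundary φ s := by
  have zero_succ : ∀ (s : Fin (k + 1) → ι) (j : Fin k),
      tupleCoboundary φ (s ∘ Equiv.swap 0 j.succ) = -tupleCoboundary φ s := by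
    intro s j
    obtain ⟨v, σ, rfl⟩ : ∃ v σ, s = Fin.cons v σ := ⟨s 0, Fin.tail s, (Fin.cons_self_tail s).symm⟩
    have h := cons_update_comp_swap σ j (σ j) v
    rw [Function.update_eq_self] at h
    rw [h]
    simp only [tupleCoboundary, Fin.tail_cons, Fin.cons_zero]
    rw [← Finset.add_sum_erase _ _ (mem_univ j), ← Finset.add_sum_erase _ _ (mem_univ j),
      Function.update_idem, Function.update_eq_self]
    have h2 : ∑ l ∈ univ.erase j, φ (Function.update (Function.update σ j v) l (σ j)) =
        -∑ l ∈ univ.erase j, φ (Function.update σ l v) := by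
      rw [← Finset.sum_neg_distrib]
      refine Finset.sum_congr rfl fun l hl => ?_
      have hlj : l ≠ j := (Finset.mem_erase.1 hl).1
      rw [← hφ _ l j hlj]
      congr 1
      funext m
      by_cases h1 : m = l
      · subst h1; simp [hlj.symm]
      · by_cases h2 : m = j
        · subst h2; simp [hlj.symm]
        · simp [h1, h2, Equiv.swap_apply_of_ne_of_ne h1 h2]
    rw [h2]; ring
  have succ_succ : ∀ (i j : Fin k), i ≠ j →
      tupleCoboundary φ (s ∘ Equiv.swap i.succ j.succ) = -tupleCoboundary φ s := by
    intro i j hij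
    obtain ⟨v, σ, rfl⟩ : ∃ v σ, s = Fin.cons v σ := ⟨s 0, Fin.tail s, (Fin.cons_self_tail s).symm⟩
    rw [cons_comp_swap_succ]
    simp only [tupleCoboundary, Fin.tail_cons, Fin.cons_zero]
    have h2 : ∑ l, φ (Function.update (σ ∘ Equiv.swap i j) l v) =
        -∑ l, φ (Function.update σ l v) := by
      rw [← Finset.sum_neg_distrib, ← Equiv.sum_comp (Equiv.swap i j)]
      refine Finset.sum_congr rfl fun l _ => ?_
      rw [← hφ _ i j hij]
      congr 1
      funext m
      by_cases h1 : m = Equiv.swap i j l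
      · subst h1; simp
      · have h3 : Equiv.swap i j m ≠ l := fun h => h1 (by rw [← h, Equiv.swap_apply_self])
        simp [Function.update_of_ne h1, Function.update_of_ne h3]
    rw [h2, hφ σ i j hij]; ring
  induction a using Fin.cases with
  | zero =>
    induction b using Fin.cases with
    | zero => exact absurd rfl hab
    | succ b => exact zero_succ s b
  | succ a =>
    induction b using Fin.cases with
    | zero => rw [Equiv.swap_comm]; exact zero_succ s a
    | succ b => exact succ_succ a b fun h => hab (by rw [h])


open Classical in
lemma sum_prod_mul_update_le [Fintype ι] [DecidableEq V] {r : ℕ} {E : ι → Finset V} {P : ι → Prop}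
    (hcard : ∀ a, (E a).card = r) {x : ι → ℝ} (hx : ∀ a, 0 ≤ x a)
    (hfm : ∀ v : V, ∑ a ∈ univ.filter (fun a => v ∈ E a), x a ≤ 1) {k : ℕ}
    {φ : (Fin k → ι) → ℝ} (hφ : ∀ σ, ¬ IsMatchingTuple E P σ → φ σ = 0)
    (hcyc : ∀ σ j, ∑ v, x v * φ (Function.update σ j v) = 0) (j : Fin k) :
    ∑ σ : Fin k → ι, ∑ v, (∏ i, x (σ i)) * φ σ * (x v *
        if IsMatchingTuple E P (Fin.cons v σ : Fin (k + 1) → ι) then φ (Function.update σ j v)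
        else 0) ≤
      ∑ σ : Fin k → ι, (∏ i, x (σ i)) * φ σ ^ 2 * (r - ∑ v, meets E (σ j) v * x v) := by
  obtain _ | k := k
  · exact j.elim0
  rw [← Equiv.sum_comp (Fin.insertNthEquiv (fun _ => ι) j),
    ← Equiv.sum_comp (Fin.insertNthEquiv (fun _ => ι) j), Fintype.sum_prod_type_right,
    Fintype.sum_prod_type_right]
  refine Finset.sum_le_sum fun τ _ => ?_
  have hins : ∀ u, Fin.insertNthEquiv (fun _ => ι) j (u, τ) =
      Fin.insertNth (α := fun _ => ι) j u τ := fun _ => rfl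
  simp only [hins, Fin.prod_univ_succAbove _ j, Fin.insertNth_apply_same,
    Fin.insertNth_apply_succAbove, Fin.update_insertNth]
  set W := ∏ i, x (τ i)
  have hW : 0 ≤ W := Finset.prod_nonneg fun i _ => hx _
  set g : ι → ℝ := fun u => φ (Fin.insertNth (α := fun _ => ι) j u τ) with hg
  have hsum : ∑ v, x v * g v = 0 := by
    have h : Nonempty ι ∨ IsEmpty ι := (isEmpty_or_nonempty ι).symm
    rcases h with ⟨⟨u⟩⟩ | h
    · simpa only [Fin.update_insertNth] using hcyc (Fin.insertNth (α := fun _ => ι) j u τ) j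
    · simp
  have hterm : ∀ u v, x u * W * g u * (x v *
      if IsMatchingTuple E P (Fin.cons v (Fin.insertNth (α := fun _ => ι) j u τ) :
        Fin (k + 1 + 1) → ι) then g v else 0) =
      W * ((x u * g u) * (x v * g v) - meets E u v * (x u * x v * (g u * g v))) := by
    intro u v
    by_cases hu : g u = 0
    · simp [hu]
    by_cases hv : g v = 0
    · simp [hv]
    have hu' : IsMatchingTuple E P (Fin.insertNth (α := fun _ => ι) j u τ) := by
      by_contra h; exact hu (hφ _ h)
    have hv' : IsMatchingTuple E P (Fin.insertNth (α := fun _ => ι) j v τ) := by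
      by_contra h; exact hv (hφ _ h)
    have hiff : IsMatchingTuple E P (Fin.cons v (Fin.insertNth (α := fun _ => ι) j u τ) :
        Fin (k + 1 + 1) → ι) ↔ Disjoint (E u) (E v) := by
      rw [isMatchingTuple_cons]
      constructor
      · intro h
        simpa using (h.2.1 j).symm
      · intro h
        refine ⟨by simpa using hv'.1 j, fun i => ?_, hu'⟩
        rcases Fin.eq_self_or_eq_succAbove j i with rfl | ⟨l, rfl⟩
        · simpa using h.symm
        · simpa using hv'.2 j (j.succAbove l) (Fin.succAbove_ne j l).symm
    rw [if_congr hiff rfl rfl]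
    unfold meets
    split_ifs <;> ring
  calc _ = W * ((∑ u, x u * g u) * (∑ v, x v * g v) -
        ∑ u, ∑ v, meets E u v * (x u * x v * (g u * g v))) := by
        rw [Finset.sum_mul_sum, ← Finset.sum_sub_distrib, Finset.mul_sum]
        refine Finset.sum_congr rfl fun u _ => ?_
        rw [← Finset.sum_sub_distrib, Finset.mul_sum]
        exact Finset.sum_congr rfl fun v _ => hterm u v
    _ ≤ W * ∑ u, x u * g u ^ 2 * (r - ∑ v, meets E u v * x v) := by
        rw [hsum]
        refine mul_le_mul_of_nonneg_left ?_ hW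
        simpa using neg_sum_meets_le hcard hx hfm g
    _ = _ := by
        rw [Finset.mul_sum]
        exact Finset.sum_congr rfl fun u _ => by ring

lemma sub_sum_meets_le [Fintype ι] {E : ι → Finset V} {P : ι → Prop}
    {x : ι → ℝ} (hx : ∀ a, 0 ≤ x a) (hxP : ∀ a, ¬ P a → x a = 0) {k : ℕ} {σ : Fin k → ι}
    (hσ : IsMatchingTuple E P σ)
    [DecidablePred fun v => IsMatchingTuple E P (Fin.cons v σ : Fin (k + 1) → ι)] [DecidableEq V] :
    ∑ v, x v - ∑ j, ∑ v, meets E (σ j) v * x v ≤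
      ∑ v, x v * if IsMatchingTuple E P (Fin.cons v σ : Fin (k + 1) → ι) then 1 else 0 := by
  rw [Finset.sum_comm, ← Finset.sum_sub_distrib]
  refine Finset.sum_le_sum fun v _ => ?_
  have h0 : ∀ j, 0 ≤ meets E (σ j) v * x v := fun j => mul_nonneg (meets_nonneg _ _ _) (hx v)
  split_ifs with h
  · have := Finset.sum_nonneg fun j (_ : j ∈ univ) => h0 j
    linarith
  · rw [mul_zero, sub_nonpos]
    by_cases hv : P v
    · have : ∃ j, ¬ Disjoint (E (σ j)) (E v) := by
        by_contra! hd
        exact h (isMatchingTuple_cons.2 ⟨hv, fun i => (hd i).symm, hσ⟩)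
      obtain ⟨j, hj⟩ := this
      calc x v = meets E (σ j) v * x v := by simp [meets, hj]
        _ ≤ _ := Finset.single_le_sum (f := fun j => meets E (σ j) v * x v) (fun j _ => h0 j)
          (mem_univ j)
    · rw [hxP v hv]; simp

open Classical in
/-- A weighted harmonic chain vanishes when the fractional matching is large. -/
lemma prod_mul_sq_eq_zero [Fintype ι] [DecidableEq V] {r : ℕ} {E : ι → Finset V} {P : ι → Prop}
    (hcard : ∀ a, (E a).card = r) {x : ι → ℝ} (hx : ∀ a, 0 ≤ x a) (hxP : ∀ a, ¬ P a → x a = 0)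
    (hfm : ∀ v : V, ∑ a ∈ univ.filter (fun a => v ∈ E a), x a ≤ 1) {k : ℕ}
    (hlarge : (r : ℝ) * k < ∑ a, x a)
    {φ : (Fin k → ι) → ℝ} (hφ : ∀ σ, ¬ IsMatchingTuple E P σ → φ σ = 0)
    (hcyc : ∀ σ j, ∑ v, x v * φ (Function.update σ j v) = 0)
    (horth : ∑ σ : Fin k → ι, φ σ * ∑ v,
      (if IsMatchingTuple E P (Fin.cons v σ : Fin (k + 1) → ι) then
        (∏ i, x ((Fin.cons v σ : Fin (k + 1) → ι) i)) * tupleCoboundary φ (Fin.cons v σ)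
      else 0) = 0) (σ : Fin k → ι) :
    (∏ i, x (σ i)) * φ σ ^ 2 = 0 := by
  have hw : ∀ σ : Fin k → ι, 0 ≤ (∏ i, x (σ i)) * φ σ ^ 2 := fun σ =>
    mul_nonneg (Finset.prod_nonneg fun i _ => hx _) (sq_nonneg _)
  set N : (Fin k → ι) → ℝ := fun σ =>
    ∑ v, x v * if IsMatchingTuple E P (Fin.cons v σ : Fin (k + 1) → ι) then 1 else 0 with hN
  have h1 : ∑ σ : Fin k → ι, (∏ i, x (σ i)) * φ σ ^ 2 * N σ =
      ∑ j, ∑ σ : Fin k → ι, ∑ v, (∏ i, x (σ i)) * φ σ * (x v *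
        if IsMatchingTuple E P (Fin.cons v σ : Fin (k + 1) → ι) then φ (Function.update σ j v)
        else 0) := by
    rw [← sub_eq_zero]
    refine Eq.trans ?_ horth
    rw [Finset.sum_comm, ← Finset.sum_sub_distrib]
    refine Finset.sum_congr rfl fun σ _ => ?_
    rw [Finset.sum_comm, hN, Finset.mul_sum, ← Finset.sum_sub_distrib, Finset.mul_sum]
    refine Finset.sum_congr rfl fun v _ => ?_
    split_ifs with h
    · simp only [tupleCoboundary, Fin.prod_univ_succ, Fin.cons_zero, Fin.cons_succ, Fin.tail_cons]
      rw [← Finset.mul_sum, ← Finset.mul_sum]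
      ring
    · simp
  have h2 : ∑ σ : Fin k → ι, (∏ i, x (σ i)) * φ σ ^ 2 * N σ ≤
      ∑ σ : Fin k → ι, (∏ i, x (σ i)) * φ σ ^ 2 *
        ∑ j, ((r : ℝ) - ∑ v, meets E (σ j) v * x v) := by
    rw [h1]
    simp only [Finset.mul_sum (s := (univ : Finset (Fin k)))]
    rw [Finset.sum_comm (s := (univ : Finset (Fin k → ι)))]
    exact Finset.sum_le_sum fun j _ => sum_prod_mul_update_le hcard hx hfm hφ hcyc j
  have h3 : ∑ σ : Fin k → ι, (∏ i, x (σ i)) * φ σ ^ 2 * (∑ a, x a - r * k) ≤ 0 := by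
    rw [← sub_nonpos, ← Finset.sum_sub_distrib] at h2
    refine le_trans (Finset.sum_le_sum fun σ _ => ?_) h2
    by_cases hσ : IsMatchingTuple E P σ
    · rw [← mul_sub]
      refine mul_le_mul_of_nonneg_left ?_ (hw σ)
      have := sub_sum_meets_le hx hxP hσ
      simp only [Finset.sum_sub_distrib, Finset.sum_const, Finset.card_univ, Fintype.card_fin,
        nsmul_eq_mul]
      simp only [hN]
      linarith
    · simp [hφ σ hσ]
  rw [← Finset.sum_mul] at h3
  have h4 : ∑ σ : Fin k → ι, (∏ i, x (σ i)) * φ σ ^ 2 = 0 := by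
    refine le_antisymm ?_ (Finset.sum_nonneg fun σ _ => hw σ)
    by_contra! h
    have := mul_pos h (sub_pos.2 hlarge)
    linarith
  exact (Finset.sum_eq_zero_iff_of_nonneg fun σ _ => hw σ).1 h4 σ (mem_univ σ)

open Classical in
/-- Vanishing of homology: cycles of the matching complex on few vertices are boundaries. -/
lemma exists_tupleBoundary_eq [Fintype ι] [DecidableEq V] {r : ℕ} {E : ι → Finset V} {P : ι → Prop}
    (hcard : ∀ a, (E a).card = r) {x : ι → ℝ} (hx : ∀ a, P a → 0 < x a)
    (hxP : ∀ a, ¬ P a → x a = 0)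
    (hfm : ∀ v : V, ∑ a ∈ univ.filter (fun a => v ∈ E a), x a ≤ 1) {k : ℕ}
    (hlarge : (r : ℝ) * k < ∑ a, x a) {z : (Fin k → ι) → ℝ}
    (hz : z ∈ matchingChains E P k) (hzc : z ∈ tupleCycles ι k) :
    ∃ y ∈ matchingChains E P (k + 1), tupleBoundary ι k y = z := by
  have hx0 : ∀ a, 0 ≤ x a := fun a => by
    by_cases h : P a
    · exact (hx a h).le
    · exact (hxP a h).ge
  set Z := matchingChains E P k ⊓ tupleCycles ι k with hZ
  set W := (matchingChains E P (k + 1)).map (tupleBoundary ι k) with hW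
  have hWZ : W ≤ Z := by
    rintro _ ⟨y, hy, rfl⟩
    exact ⟨tupleBoundary_mem_matchingChains hy, tupleBoundary_mem_tupleCycles hy⟩
  suffices h : W = Z by
    have : z ∈ W := h ▸ (⟨hz, hzc⟩ : z ∈ Z)
    exact this
  by_contra hne
  have hlt : Module.finrank ℝ W < Module.finrank ℝ Z :=
    Submodule.finrank_lt_finrank_of_lt (lt_of_le_of_ne hWZ hne)
  let B : ((Fin k → ι) → ℝ) →ₗ[ℝ] ((Fin k → ι) → ℝ) →ₗ[ℝ] ℝ :=
    LinearMap.mk₂ ℝ (fun f g => ∑ σ : Fin k → ι, f σ / (∏ i, x (σ i)) * g σ)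
      (fun f f' g => by simp [add_div, add_mul, Finset.sum_add_distrib])
      (fun a f g => by simp [mul_div_assoc, mul_assoc, Finset.mul_sum])
      (fun f g g' => by simp [mul_add, Finset.sum_add_distrib])
      (fun a f g => by simp [Finset.mul_sum, mul_left_comm])
  let L : Z →ₗ[ℝ] Module.Dual ℝ W := (B.compr₂ LinearMap.id).domRestrict₁₂ Z W
  have hker : L.ker ≠ ⊥ := by
    refine LinearMap.ker_ne_bot_of_finrank_lt ?_
    rwa [Subspace.dual_finrank_eq]
  obtain ⟨⟨f, hfc, hfz⟩, hfL, hf0⟩ := (Submodule.ne_bot_iff _).1 hker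
  have hBf : ∀ y ∈ matchingChains E P (k + 1),
      ∑ σ : Fin k → ι, f σ / (∏ i, x (σ i)) * tupleBoundary ι k y σ = 0 := fun y hy =>
    LinearMap.congr_fun (LinearMap.mem_ker.1 hfL) ⟨_, y, hy, rfl⟩
  set φ : (Fin k → ι) → ℝ := fun σ => f σ / ∏ i, x (σ i) with hφ
  have hwpos : ∀ σ : Fin k → ι, IsMatchingTuple E P σ → 0 < ∏ i, x (σ i) := fun σ hσ =>
    Finset.prod_pos fun i _ => hx _ (hσ.1 i)
  have hprod : ∀ {m : ℕ} (σ : Fin m → ι) (i j : Fin m),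
      ∏ l, x ((σ ∘ Equiv.swap i j) l) = ∏ l, x (σ l) := fun σ i j =>
    Equiv.prod_comp (Equiv.swap i j) fun l => x (σ l)
  have hφ0 : ∀ σ, ¬ IsMatchingTuple E P σ → φ σ = 0 := fun σ h => by simp [hφ, hfc.2 σ h]
  have hφalt : ∀ σ i j, i ≠ j → φ (σ ∘ Equiv.swap i j) = -φ σ := fun σ i j hij => by
    simp only [hφ, hprod, hfc.1 σ i j hij, neg_div]
  have hfφ : ∀ σ, f σ = (∏ i, x (σ i)) * φ σ := fun σ => by
    by_cases h : IsMatchingTuple E P σ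
    · simp only [hφ]
      rw [mul_div_cancel₀ _ (hwpos σ h).ne']
    · rw [hφ0 σ h, hfc.2 σ h, mul_zero]
  have hcyc : ∀ σ j, ∑ v, x v * φ (Function.update σ j v) = 0 := by
    intro σ j
    have hw : ∀ v, ∏ i, x (Function.update σ j v i) = x v * ∏ i ∈ univ.erase j, x (σ i) := by
      intro v
      rw [← Finset.mul_prod_erase _ _ (mem_univ j), Function.update_self]
      congr 1
      exact Finset.prod_congr rfl fun i hi => by
        rw [Function.update_of_ne (Finset.mem_erase.1 hi).1]
    have hf := hfz σ j
    simp only [hfφ, hw] at hf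
    by_cases h0 : ∏ i ∈ univ.erase j, x (σ i) = 0
    · obtain ⟨i, hi, hi0⟩ := Finset.prod_eq_zero_iff.1 h0
      refine Finset.sum_eq_zero fun v _ => ?_
      rw [hφ0, mul_zero]
      intro hm
      have := hm.1 i
      rw [Function.update_of_ne (Finset.mem_erase.1 hi).1] at this
      exact (hx _ this).ne' hi0
    · refine (mul_eq_zero.1 ?_).resolve_left h0
      rw [← hf, Finset.mul_sum]
      exact Finset.sum_congr rfl fun v _ => by ring
  refine hf0 (Subtype.ext (funext fun σ => ?_))
  have horth := hBf (fun s => if IsMatchingTuple E P s then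
      (∏ i, x (s i)) * tupleCoboundary φ s else 0) ⟨fun s i j hij => by
    beta_reduce
    rw [if_congr (isMatchingTuple_comp_swap i j) rfl rfl, hprod,
      tupleCoboundary_comp_swap hφalt s i j hij]
    split_ifs <;> simp, fun s hs => if_neg hs⟩
  have hzero := prod_mul_sq_eq_zero hcard hx0 hxP hfm hlarge hφ0 hcyc horth σ
  rw [sq, ← mul_assoc, ← hfφ] at hzero
  rcases mul_eq_zero.1 hzero with h | h
  · exact h
  · exact (hfφ σ).trans (by rw [h, mul_zero]; rfl)

end Chains

section Coloring

variable {V ι : Type} {n : ℕ}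

/-- The total value of a chain on the tuples with color pattern `t`. -/
def colorSum [Fintype ι] (c : ι → Fin n) {k : ℕ} (t : Fin k → Fin n) (f : (Fin k → ι) → ℝ) : ℝ :=
  ∑ σ : Fin k → ι, if c ∘ σ = t then f σ else 0

lemma colorSum_eq_zero_of_eq [Fintype ι] {E : ι → Finset V} {P : ι → Prop} {c : ι → Fin n} {k : ℕ}
    {t : Fin k → Fin n} {f : (Fin k → ι) → ℝ} (hf : f ∈ matchingChains E P k)
    {i j : Fin k} (hij : i ≠ j) (ht : t i = t j) : colorSum c t f = 0 := by
  have htt : t ∘ Equiv.swap i j = t := by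
    funext l
    rcases eq_or_ne l i with rfl | h1
    · simp [ht]
    rcases eq_or_ne l j with rfl | h2
    · simp [ht]
    simp [Equiv.swap_apply_of_ne_of_ne h1 h2]
  have h : colorSum c t f = -colorSum c t f := by
    unfold colorSum
    rw [← Finset.sum_neg_distrib]
    refine Fintype.sum_equiv (Equiv.arrowCongr (Equiv.swap i j) (Equiv.refl ι)) _ _ fun σ => ?_
    have h1 : Equiv.arrowCongr (Equiv.swap i j) (Equiv.refl ι) σ = σ ∘ Equiv.swap i j := by
      funext l; simp [Equiv.arrowCongr]
    have h2 : c ∘ σ ∘ Equiv.swap i j = t ↔ c ∘ σ = t := by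
      rw [← Function.comp_assoc]
      nth_rewrite 1 [← htt]
      exact (Equiv.swap i j).surjective.injective_comp_right.eq_iff
    rw [h1, if_congr h2 rfl rfl, hf.1 σ i j hij]
    split_ifs <;> simp
  linarith

lemma colorSum_eq_zero_of_notMem [Fintype ι] {E : ι → Finset V} {c : ι → Fin n} {I : Finset (Fin n)} {k : ℕ}
    {t : Fin k → Fin n} {f : (Fin k → ι) → ℝ} (hf : f ∈ matchingChains E (fun a => c a ∈ I) k)
    {i : Fin k} (ht : t i ∉ I) : colorSum c t f = 0 := by
  refine Finset.sum_eq_zero fun σ _ => ?_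
  split_ifs with h
  · refine hf.2 σ fun hm => ht ?_
    rw [← h]; exact hm.1 i
  · rfl

lemma colorSum_tupleBoundary [Fintype ι] (c : ι → Fin n) {k : ℕ} (t : Fin k → Fin n)
    (f : (Fin (k + 1) → ι) → ℝ) :
    colorSum c t (tupleBoundary ι k f) =
      ∑ i, colorSum c (Fin.cons i t : Fin (k + 1) → Fin n) f := by
  have h : ∀ i, colorSum c (Fin.cons i t : Fin (k + 1) → Fin n) f =
      ∑ τ : Fin k → ι, ∑ v, if c v = i then (if c ∘ τ = t then f (Fin.cons v τ) else 0) else 0 := by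
    intro i
    unfold colorSum
    rw [← Equiv.sum_comp (Fin.consEquiv fun _ => ι), Fintype.sum_prod_type_right]
    refine Finset.sum_congr rfl fun τ _ => Finset.sum_congr rfl fun v _ => ?_
    have h1 : Fin.consEquiv (fun _ => ι) (v, τ) = Fin.cons v τ := rfl
    have h2 : (c ∘ (Fin.cons v τ : Fin (k + 1) → ι) = Fin.cons i t) ↔ (c v = i ∧ c ∘ τ = t) := by
      rw [← Fin.cons_inj (α := fun _ => Fin n)]
      have : c ∘ (Fin.cons v τ : Fin (k + 1) → ι) = Fin.cons (c v) (c ∘ τ) := by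
        funext l; refine Fin.cases ?_ (fun l => ?_) l <;> simp
      rw [this]
    rw [h1, if_congr h2 rfl rfl, ite_and]
  simp only [h]
  rw [Finset.sum_comm]
  refine Finset.sum_congr rfl fun τ _ => ?_
  rw [Finset.sum_comm, tupleBoundary_apply]
  simp only [Finset.sum_ite_eq, mem_univ, if_true]
  split_ifs <;> simp

/-- The sign of the face of the simplex `I` opposite to `i`. -/
def faceSign (I : Finset (Fin n)) (i : Fin n) : ℝ := (-1) ^ (I.filter (· < i)).card

/-- The chain attached to the boundary of the simplex `I` by chains attached to its facets. -/
def faceSum {M : Type} [AddCommGroup M] [Module ℝ M] (F : Finset (Fin n) → M)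
    (I : Finset (Fin n)) : M :=
  ∑ i ∈ I, faceSign I i • F (I.erase i)

lemma faceSign_mul_antisymm {I : Finset (Fin n)} {i j : Fin n} (hi : i ∈ I) (hj : j ∈ I)
    (hij : i ≠ j) :
    faceSign I i * faceSign (I.erase i) j = -(faceSign I j * faceSign (I.erase j) i) := by
  wlog h : i < j generalizing i j
  · rw [this hj hi hij.symm (lt_of_le_of_ne (not_lt.1 h) hij.symm), neg_neg]
  have h1 : (I.erase j).filter (· < i) = I.filter (· < i) := by
    ext l; simp only [mem_filter, mem_erase]
    exact ⟨fun h => ⟨h.1.2, h.2⟩, fun h' => ⟨⟨(h'.2.trans h).ne, h'.1⟩, h'.2⟩⟩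
  have h2 : ((I.erase i).filter (· < j)).card + 1 = (I.filter (· < j)).card := by
    rw [Finset.filter_erase]
    exact Finset.card_erase_add_one (mem_filter.2 ⟨hi, h⟩)
  unfold faceSign
  rw [h1, ← h2, pow_succ]
  ring

lemma faceSum_faceSum {M : Type} [AddCommGroup M] [Module ℝ M] (F : Finset (Fin n) → M)
    (I : Finset (Fin n)) : faceSum (faceSum F) I = 0 := by
  have h : faceSum (faceSum F) I = ∑ i, ∑ j, if i ∈ I ∧ j ∈ I ∧ i ≠ j then
      (faceSign I i * faceSign (I.erase i) j) • F ((I.erase i).erase j) else 0 := by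
    simp only [faceSum, Finset.smul_sum, smul_smul]
    rw [← Finset.sum_filter_add_sum_filter_not univ (· ∈ I)]
    rw [Finset.sum_eq_zero (s := univ.filter (· ∉ I))
      (fun i hi => Finset.sum_eq_zero fun j _ => if_neg fun h => (mem_filter.1 hi).2 h.1), add_zero]
    refine Finset.sum_congr (by ext; simp) fun i hi => ?_
    rw [← Finset.sum_filter]
    refine Finset.sum_congr ?_ fun _ _ => rfl
    ext j
    simp only [mem_erase, mem_filter, mem_univ, true_and, (mem_filter.1 hi).2, ne_comm (a := i),
      and_comm]
  have h' : faceSum (faceSum F) I = -faceSum (faceSum F) I := by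
    nth_rewrite 1 [h]
    rw [Finset.sum_comm, h, ← Finset.sum_neg_distrib]
    refine Finset.sum_congr rfl fun i _ => ?_
    rw [← Finset.sum_neg_distrib]
    refine Finset.sum_congr rfl fun j _ => ?_
    by_cases hc : i ∈ I ∧ j ∈ I ∧ i ≠ j
    · rw [if_pos hc, if_pos ⟨hc.2.1, hc.1, hc.2.2.symm⟩,
        faceSign_mul_antisymm hc.2.1 hc.1 hc.2.2.symm, Finset.erase_right_comm, neg_smul]
    · rw [if_neg hc, if_neg fun h => hc ⟨h.2.1, h.1, h.2.2.symm⟩, neg_zero]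
  have h2 : (2 : ℝ) • faceSum (faceSum F) I = 0 := by
    rw [two_smul]; exact add_eq_zero_iff_eq_neg.2 h'
  exact (smul_eq_zero.1 h2).resolve_left two_ne_zero

lemma matchingChains_mono {E : ι → Finset V} {P Q : ι → Prop} (h : ∀ a, P a → Q a) {k : ℕ} :
    matchingChains E P k ≤ matchingChains E Q k :=
  fun _ hf => ⟨hf.1, fun σ hσ => hf.2 σ fun hm => hσ ⟨fun i => h _ (hm.1 i), hm.2⟩⟩

lemma faceSum_mem_matchingChains [Fintype ι] {E : ι → Finset V} {c : ι → Fin n} {k : ℕ}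
    {F : Finset (Fin n) → (Fin k → ι) → ℝ}
    (hF : ∀ I : Finset (Fin n), I.card = k → F I ∈ matchingChains E (fun a => c a ∈ I) k)
    {I : Finset (Fin n)} (hI : I.card = k + 1) :
    faceSum F I ∈ matchingChains E (fun a => c a ∈ I) k :=
  Submodule.sum_mem _ fun i hi => Submodule.smul_mem _ _
    (matchingChains_mono (fun _ h => mem_of_mem_erase h)
      (hF _ (by rw [Finset.card_erase_of_mem hi, hI]; rfl)))

lemma colorSum_tail_tupleBoundary [Fintype ι] {E : ι → Finset V} {c : ι → Fin n} {k : ℕ}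
    {t : Fin (k + 1) → Fin n} {y : (Fin (k + 1) → ι) → ℝ}
    (hy : y ∈ matchingChains E (fun a => c a ∈ univ.image t) (k + 1)) :
    colorSum c (Fin.tail t) (tupleBoundary ι k y) = colorSum c t y := by
  rw [colorSum_tupleBoundary, Finset.sum_eq_single (t 0), Fin.cons_self_tail]
  · intro i _ hi
    by_cases him : i ∈ univ.image t
    · obtain ⟨l, -, rfl⟩ := mem_image.1 him
      obtain ⟨l, rfl⟩ := Fin.exists_succ_eq.2 fun h : l = 0 => hi (by rw [h])
      exact colorSum_eq_zero_of_eq hy (Fin.succ_ne_zero l).symm (by simp [Fin.tail])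
    · exact colorSum_eq_zero_of_notMem hy (i := 0) (by simpa using him)
  · simp

lemma colorSum_faceSum_of_strictMono [Fintype ι] {E : ι → Finset V} {c : ι → Fin n} {k : ℕ}
    {F : Finset (Fin n) → (Fin k → ι) → ℝ}
    (hF : ∀ I : Finset (Fin n), I.card = k → F I ∈ matchingChains E (fun a => c a ∈ I) k)
    {t : Fin (k + 1) → Fin n} (ht : StrictMono t) :
    colorSum c (Fin.tail t) (faceSum F (univ.image t)) =
      colorSum c (Fin.tail t) (F (univ.image (Fin.tail t))) := by
  have hlin : colorSum c (Fin.tail t) (faceSum F (univ.image t)) =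
      ∑ i ∈ univ.image t, faceSign (univ.image t) i *
        colorSum c (Fin.tail t) (F ((univ.image t).erase i)) := by
    simp only [colorSum, faceSum, Finset.mul_sum, Finset.sum_apply, Pi.smul_apply, smul_eq_mul]
    rw [Finset.sum_comm]
    refine Finset.sum_congr rfl fun σ _ => ?_
    split_ifs <;> simp
  have hcard : (univ.image t).card = k + 1 := by
    rw [Finset.card_image_of_injective _ ht.injective]; simp
  have h0 : t 0 ∈ univ.image t := mem_image_of_mem _ (mem_univ _)
  have herase : (univ.image t).erase (t 0) = univ.image (Fin.tail t) := by
    ext i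
    simp only [mem_erase, mem_image, mem_univ, true_and, Fin.tail]
    constructor
    · rintro ⟨hi, l, rfl⟩
      obtain ⟨l, rfl⟩ := Fin.exists_succ_eq.2 fun h : l = 0 => hi (by rw [h])
      exact ⟨l, rfl⟩
    · rintro ⟨l, rfl⟩
      exact ⟨(ht (Fin.succ_pos l)).ne', l.succ, rfl⟩
  have hsign : faceSign (univ.image t) (t 0) = 1 := by
    have : (univ.image t).filter (· < t 0) = ∅ := by
      ext i
      simp only [mem_filter, mem_image, mem_univ, true_and, notMem_empty, iff_false, not_and,
        not_lt]
      rintro ⟨l, rfl⟩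
      exact ht.monotone (Fin.zero_le l)
    simp [faceSign, this]
  rw [hlin, Finset.sum_eq_single (t 0), hsign, one_mul, herase]
  · intro i him hi
    obtain ⟨l, -, rfl⟩ := mem_image.1 him
    obtain ⟨l, rfl⟩ := Fin.exists_succ_eq.2 fun h : l = 0 => hi (by rw [h])
    rw [colorSum_eq_zero_of_notMem (hF _ (by rw [Finset.card_erase_of_mem him, hcard]; rfl))
      (i := l) (by simp [Fin.tail]), mul_zero]
  · exact fun h => absurd h0 h

/-- Homological Hall theorem: if the complex of matchings using only the colors in `I` has no
homology in the relevant degree for every `I`, then there is a full rainbow matching. -/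
lemma hasFullRainbowMatching_of_acyclic [Fintype ι] {E : ι → Finset V} {c : ι → Fin n}
    (hacyc : ∀ (k : ℕ) (I : Finset (Fin n)), I.card = k + 1 →
      ∀ z ∈ matchingChains E (fun a => c a ∈ I) k, z ∈ tupleCycles ι k →
        ∃ y ∈ matchingChains E (fun a => c a ∈ I) (k + 1), tupleBoundary ι k y = z) :
    hasFullRainbowMatching E c := by
  have key : ∀ k : ℕ, ∃ F : Finset (Fin n) → (Fin k → ι) → ℝ,
      (∀ I : Finset (Fin n), I.card = k → F I ∈ matchingChains E (fun a => c a ∈ I) k) ∧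
      (∀ I : Finset (Fin n), I.card = k + 1 → faceSum F I ∈ tupleCycles ι k) ∧
      ∀ t : Fin k → Fin n, StrictMono t → colorSum c t (F (univ.image t)) = 1 := by
    intro k
    induction k with
    | zero =>
      refine ⟨fun _ _ => 1, fun I _ => ⟨fun _ i => i.elim0, fun σ hσ => absurd ?_ hσ⟩,
        fun I _ _ j => j.elim0, fun t _ => ?_⟩
      · exact ⟨fun i => i.elim0, fun i => i.elim0⟩
      · simp [colorSum, eq_iff_true_of_subsingleton]
    | succ k ih =>
      obtain ⟨F, hF, hFc, hFt⟩ := ih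
      have hex : ∀ I : Finset (Fin n), ∃ y, I.card = k + 1 →
          y ∈ matchingChains E (fun a => c a ∈ I) (k + 1) ∧ tupleBoundary ι k y = faceSum F I := by
        intro I
        by_cases hI : I.card = k + 1
        · obtain ⟨y, hy, hyb⟩ := hacyc k I hI _ (faceSum_mem_matchingChains hF hI) (hFc I hI)
          exact ⟨y, fun _ => ⟨hy, hyb⟩⟩
        · exact ⟨0, fun h => absurd h hI⟩
      choose G hG using hex
      refine ⟨G, fun I hI => (hG I hI).1, fun I hI => ?_, fun t ht => ?_⟩
      · refine mem_tupleCycles_of_tupleBoundary_eq_zero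
          (faceSum_mem_matchingChains (fun J hJ => (hG J hJ).1) hI) ?_
        rw [← faceSum_faceSum F I]
        unfold faceSum
        rw [map_sum]
        refine Finset.sum_congr rfl fun i hi => ?_
        rw [map_smul, (hG _ (by rw [Finset.card_erase_of_mem hi, hI]; rfl)).2]
        rfl
      · have hcard : (univ.image t).card = k + 1 := by
          rw [Finset.card_image_of_injective _ ht.injective]; simp
        obtain ⟨h1, h2⟩ := hG _ hcard
        rw [← colorSum_tail_tupleBoundary h1, h2,
          colorSum_faceSum_of_strictMono hF ht]
        exact hFt _ fun i j hij => ht (Fin.succ_lt_succ_iff.2 hij)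
  obtain ⟨F, hF, -, hFt⟩ := key n
  have h1 := hFt id strictMono_id
  have hne : colorSum c id (F (univ.image id)) ≠ 0 := by rw [h1]; exact one_ne_zero
  obtain ⟨σ, -, hσ⟩ := Finset.exists_ne_zero_of_sum_ne_zero hne
  split_ifs at hσ with hc
  · refine ⟨σ, congrFun hc, ?_⟩
    by_contra hd
    exact hσ ((hF (univ.image id) (by simp)).2 σ fun hm => hd hm.2)
  · exact absurd rfl hσ

end Coloring

/-- A fractional matching may be assumed positive on the given edges. -/
lemma exists_pos_fractionalMatching {V ι : Type} [Fintype ι] [DecidableEq V] (E : ι → Finset V)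
    (P : ι → Prop) {s : ℝ} {x : ι → ℝ} (hx : ∀ a, 0 ≤ x a) (hxP : ∀ a, ¬ P a → x a = 0)
    (hfm : ∀ v : V, ∑ a ∈ univ.filter (fun a => v ∈ E a), x a ≤ 1) (hs : s < ∑ a, x a) :
    ∃ y : ι → ℝ, (∀ a, P a → 0 < y a) ∧ (∀ a, ¬ P a → y a = 0) ∧
      (∀ v : V, ∑ a ∈ univ.filter (fun a => v ∈ E a), y a ≤ 1) ∧ s < ∑ a, y a := by
  classical
  set S := ∑ a, x a
  have hS : 0 ≤ S := Finset.sum_nonneg fun a _ => hx a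
  set d := S - s with hd
  have hd0 : 0 < d := sub_pos.2 hs
  set ε := d / (S + d + 1) with hε
  have hD : 0 < S + d + 1 := by linarith
  have hε0 : 0 < ε := div_pos hd0 hD
  have hε1 : ε ≤ 1 := (div_le_one hD).2 (by linarith)
  have hεS : ε * S < d := by
    rw [hε, div_mul_eq_mul_div, div_lt_iff₀ hD]
    nlinarith
  set u : ι → ℝ := fun a => if P a then 1 / ((Fintype.card ι : ℝ) + 1) else 0 with hu
  have hN : (0 : ℝ) < (Fintype.card ι : ℝ) + 1 := by positivity
  have hu0 : ∀ a, 0 ≤ u a := fun a => by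
    simp only [hu]; split_ifs <;> positivity
  have hu1 : ∑ a, u a ≤ 1 := by
    calc ∑ a, u a ≤ ∑ _a : ι, 1 / ((Fintype.card ι : ℝ) + 1) := Finset.sum_le_sum fun a _ => by
          simp only [hu]
          split_ifs
          · exact le_rfl
          · positivity
      _ ≤ 1 := by
          rw [Finset.sum_const, Finset.card_univ, nsmul_eq_mul, mul_one_div, div_le_one hN]
          linarith
  refine ⟨fun a => (1 - ε) * x a + ε * u a, fun a ha => ?_, fun a ha => ?_, fun v => ?_, ?_⟩
  · have h1 : 0 < u a := by simp only [hu, if_pos ha]; positivity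
    have h2 := mul_nonneg (sub_nonneg.2 hε1) (hx a)
    have h3 := mul_pos hε0 h1
    linarith
  · simp [hu, ha, hxP a ha]
  · rw [Finset.sum_add_distrib, ← Finset.mul_sum, ← Finset.mul_sum]
    have h1 : ∑ a ∈ univ.filter (fun a => v ∈ E a), u a ≤ 1 :=
      (Finset.sum_le_sum_of_subset_of_nonneg (filter_subset _ _) fun a _ _ => hu0 a).trans hu1
    nlinarith [mul_le_mul_of_nonneg_left (hfm v) (sub_nonneg.2 hε1),
      mul_le_mul_of_nonneg_left h1 hε0.le]
  · rw [Finset.sum_add_distrib, ← Finset.mul_sum, ← Finset.mul_sum]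
    have h1 := mul_nonneg hε0.le (Finset.sum_nonneg fun a (_ : a ∈ univ) => hu0 a)
    change s < (1 - ε) * S + _
    linarith

/-- Theorem of Aharoni, Berger, and Meshulam: if `G` is an `r`-graph and for every set `I` of
colors there is a fractional matching on `∪_{i ∈ I} E_i` of total weight greater than
`r(|I|-1)`, then there is a full rainbow matching. -/
theorem stmt13 {V ι : Type} [Fintype ι] [DecidableEq V]
    (r n : ℕ) (hr : 1 ≤ r)
    (E : ι → Finset V) (hcard : ∀ a, (E a).card = r)
    (c : ι → Fin n)
    (hfrac : ∀ I : Finset (Fin n), ∃ x : ι → ℝ,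
      (∀ a, 0 ≤ x a) ∧
      (∀ a, c a ∉ I → x a = 0) ∧
      (∀ v : V, ∑ a ∈ Finset.univ.filter (fun a => v ∈ E a), x a ≤ 1) ∧
      (r : ℝ) * ((I.card : ℝ) - 1) < ∑ a ∈ Finset.univ.filter (fun a => c a ∈ I), x a) :
    hasFullRainbowMatching E c := by
  refine hasFullRainbowMatching_of_acyclic fun k I hI z hz hzc => ?_
  obtain ⟨x, hx, hxI, hfm, hlt⟩ := hfrac I
  have hsum : ∑ a ∈ univ.filter (fun a => c a ∈ I), x a = ∑ a, x a :=
    Finset.sum_subset (filter_subset _ _) fun a _ ha =>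
      hxI a fun h => ha (mem_filter.2 ⟨mem_univ a, h⟩)
  rw [hsum, hI, Nat.cast_add_one, add_sub_cancel_right] at hlt
  obtain ⟨y, hy, hyI, hyfm, hylt⟩ := exists_pos_fractionalMatching E (fun a => c a ∈ I) hx hxI hfm
    hlt
  exact exists_tupleBoundary_eq hcard hy hyI hyfm hylt hz hzc
end

section
/- Let G be an r-graph (r ≥ 1) with maximum degree Δ, and let E_1, …, E_n be the color classes of an edge-coloring of G, where n ≥ 2. If |E_i| ≥ ⌊(n−1)rΔ/n⌋ + 1 for every i ∈ {1,…,n}, then G has a full rainbow matching with respect to E_1, …, E_n. -/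
open Finset

section SignedBoundary

variable {α : Type} [LinearOrder α]

/-- The sign of inserting `a` into `s`: the parity of the number of elements of `s` below `a`. -/
def insertSign (a : α) (s : Finset α) : ℝ := (-1) ^ (s.filter (· < a)).card

lemma insertSign_mul_self (a : α) (s : Finset α) : insertSign a s * insertSign a s = 1 := by
  rw [insertSign, ← mul_pow]; simp

lemma insertSign_insert_self (a : α) (s : Finset α) :
    insertSign a (insert a s) = insertSign a s := by
  simp [insertSign, Finset.filter_insert]

lemma insertSign_insert {a b : α} {s : Finset α} (hb : b ∉ s) :
    insertSign a (insert b s) = (if b < a then -1 else 1) * insertSign a s := by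
  unfold insertSign
  rw [Finset.filter_insert]
  split_ifs with h
  · rw [Finset.card_insert_of_notMem (by simp [hb]), pow_succ]; ring
  · ring

lemma insertSign_swap {a b : α} {s : Finset α} (hab : a ≠ b) (ha : a ∉ s) (hb : b ∉ s) :
    insertSign a (insert b s) * insertSign b (insert a s) = -(insertSign a s * insertSign b s) := by
  rw [insertSign_insert hb, insertSign_insert ha]
  rcases lt_or_gt_of_ne hab with h | h
  · simp [h, h.not_gt]
  · simp [h, h.not_gt]

lemma insertSign_anticomm {a b : α} {s : Finset α} (hab : a ≠ b) (ha : a ∉ s) (hb : b ∉ s) :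
    insertSign a s * insertSign b (insert a s) = -(insertSign b s * insertSign a (insert b s)) := by
  rw [insertSign_insert hb, insertSign_insert ha]
  rcases lt_or_gt_of_ne hab with h | h
  · simp [h, h.not_gt, mul_comm]
  · simp [h, h.not_gt, mul_comm]

variable [Fintype α] {M : Type} [AddCommGroup M] [Module ℝ M]

/-- The boundary operator on `M`-valued simplicial chains, with the vertex `a` weighted
by `f a`. -/
def signedBoundary (f : α → ℝ) : (Finset α → M) →ₗ[ℝ] (Finset α → M) where
  toFun x s := ∑ a, if a ∈ s then 0 else (f a * insertSign a s) • x (insert a s)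
  map_add' x y := by
    ext s
    simp only [Pi.add_apply, ← Finset.sum_add_distrib]
    refine Finset.sum_congr rfl fun a _ => ?_
    split_ifs <;> simp
  map_smul' r x := by
    ext s
    simp only [Pi.smul_apply, RingHom.id_apply, Finset.smul_sum]
    refine Finset.sum_congr rfl fun a _ => ?_
    split_ifs
    · simp
    · rw [smul_comm]

lemma signedBoundary_apply (f : α → ℝ) (x : Finset α → M) (s : Finset α) :
    signedBoundary f x s =
      ∑ a, if a ∈ s then 0 else (f a * insertSign a s) • x (insert a s) := rfl

lemma signedBoundary_sum {κ : Type} (S : Finset κ) (f : κ → α → ℝ) (x : Finset α → M) :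
    signedBoundary (∑ i ∈ S, f i) x = ∑ i ∈ S, signedBoundary (f i) x := by
  ext s
  simp only [Finset.sum_apply, signedBoundary_apply]
  rw [Finset.sum_comm]
  refine Finset.sum_congr rfl fun a _ => ?_
  split_ifs
  · simp
  · rw [Finset.sum_mul, Finset.sum_smul]

lemma signedBoundary_anticomm (f g : α → ℝ) (x : Finset α → M) :
    signedBoundary f (signedBoundary g x) = -signedBoundary g (signedBoundary f x) := by
  have key : ∀ (f g : α → ℝ) (s : Finset α), signedBoundary f (signedBoundary g x) s =
      ∑ a, ∑ b, if a ∈ s ∨ b ∈ s ∨ a = b then 0 else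
        (f a * g b * (insertSign a s * insertSign b (insert a s))) •
          x (insert a (insert b s)) := by
    intro f g s
    rw [signedBoundary_apply]
    refine Finset.sum_congr rfl fun a _ => ?_
    by_cases ha : a ∈ s
    · simp [ha]
    simp only [ha, if_false, false_or]
    rw [signedBoundary_apply, Finset.smul_sum]
    refine Finset.sum_congr rfl fun b _ => ?_
    by_cases hb : b ∈ s
    · simp [hb]
    by_cases hab : a = b
    · simp [hab]
    simp only [Finset.mem_insert, hb, hab, Ne.symm hab, or_self, if_false]
    rw [smul_smul, Finset.insert_comm b a s]
    congr 1; ring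
  ext s
  rw [Pi.neg_apply, key f g, key g f, Finset.sum_comm, ← Finset.sum_neg_distrib]
  refine Finset.sum_congr rfl fun b _ => ?_
  rw [← Finset.sum_neg_distrib]
  refine Finset.sum_congr rfl fun a _ => ?_
  by_cases hb : b ∈ s
  · simp [hb]
  by_cases ha : a ∈ s
  · simp [ha]
  by_cases hab : a = b
  · simp [hab]
  simp only [ha, hb, hab, Ne.symm hab, or_self, if_false]
  rw [insertSign_anticomm hab ha hb, Finset.insert_comm b a s, ← neg_smul]
  congr 1; ring

lemma signedBoundary_self (f : α → ℝ) (x : Finset α → M) :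
    signedBoundary f (signedBoundary f x) = 0 := by
  have h := eq_neg_iff_add_eq_zero.mp (signedBoundary_anticomm f f x)
  rw [← two_smul ℝ] at h
  exact (smul_eq_zero.mp h).resolve_left two_ne_zero

lemma exists_insert_ne_zero_of_signedBoundary {f : α → ℝ} {x : Finset α → M} {s : Finset α}
    (h : signedBoundary f x s ≠ 0) : ∃ a ∉ s, f a ≠ 0 ∧ x (insert a s) ≠ 0 := by
  obtain ⟨a, -, ha⟩ := Finset.exists_ne_zero_of_sum_ne_zero h
  by_cases has : a ∈ s
  · simp [has] at ha
  simp only [has, if_false] at ha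
  refine ⟨a, has, fun h0 => ha (by simp [h0]), fun h0 => ha (by simp [h0])⟩

lemma sum_sum_mem_erase {R : Type} [AddCommMonoid R] (F : Finset α → α → R) :
    ∑ s : Finset α, ∑ b ∈ s, F (s.erase b) b =
      ∑ t : Finset α, ∑ b, if b ∈ t then 0 else F t b := by
  have h : ∀ t : Finset α, (∑ b, if b ∈ t then 0 else F t b) = ∑ b ∈ tᶜ, F t b := by
    intro t
    rw [← Finset.sum_filter_add_sum_filter_not Finset.univ (· ∈ t)]
    rw [Finset.sum_eq_zero (by simp +contextual), zero_add]
    refine Finset.sum_congr (by ext; simp) (by simp +contextual)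
  simp only [h]
  rw [Finset.sum_sigma', Finset.sum_sigma']
  refine Finset.sum_bij' (fun p _ => ⟨p.1.erase p.2, p.2⟩) (fun p _ => ⟨insert p.2 p.1, p.2⟩)
    ?_ ?_ ?_ ?_ ?_
  · simp
  · simp
  · rintro ⟨s, b⟩ h; simp at h; simp [h]
  · rintro ⟨s, b⟩ h; simp at h; simp [h]
  · simp

end SignedBoundary

section Acyclicity

variable {ι : Type}

/-- The chains supported on the `m`-subsets of `W` whose distinct members have
vanishing pairing under `K`. -/
def orthogonalChains (K : ι → ι → ℝ) (W : Finset ι) (m : ℕ) : Submodule ℝ (Finset ι → ℝ) where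
  carrier := {x | ∀ s, x s ≠ 0 → s.card = m ∧ s ⊆ W ∧ ∀ a ∈ s, ∀ b ∈ s, a ≠ b → K a b = 0}
  zero_mem' := by intro s hs; simp at hs
  add_mem' := by
    intro x y hx hy s hs
    by_cases h : x s = 0
    · exact hy s fun h' => hs (by simp [h, h'])
    · exact hx s h
  smul_mem' := by
    intro r x hx s hs
    exact hx s fun h => hs (by simp [h])

variable {K : ι → ι → ℝ} {W : Finset ι} {m : ℕ}

lemma orthogonalChains_mono {W W' : Finset ι} (h : W ⊆ W') (m : ℕ) :
    orthogonalChains K W m ≤ orthogonalChains K W' m :=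
  fun _ hx s hs => ⟨(hx s hs).1, (hx s hs).2.1.trans h, (hx s hs).2.2⟩

variable [LinearOrder ι] [Fintype ι]

lemma signedBoundary_mem_orthogonalChains {f : ι → ℝ} {x : Finset ι → ℝ}
    (hx : x ∈ orthogonalChains K W (m + 1)) : signedBoundary f x ∈ orthogonalChains K W m := by
  intro s hs
  obtain ⟨a, ha, -, hxa⟩ := exists_insert_ne_zero_of_signedBoundary hs
  obtain ⟨h1, h2, h3⟩ := hx _ hxa
  rw [Finset.card_insert_of_notMem ha] at h1
  exact ⟨by omega, fun b hb => h2 (Finset.mem_insert_of_mem hb),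
    fun b hb c hc => h3 b (Finset.mem_insert_of_mem hb) c (Finset.mem_insert_of_mem hc)⟩

/-- The Bochner-type identity for harmonic chains. -/
lemma sum_degree_mul_sq (hsymm : ∀ a b, K a b = K b a)
    (hpos : ∀ a, K a a ≠ 0) {h : Finset ι → ℝ} (hh : h ∈ orthogonalChains K W m)
    (hco : ∀ s : Finset ι, s.card = m + 1 → s ⊆ W →
      (∀ a ∈ s, ∀ b ∈ s, a ≠ b → K a b = 0) →
      ∑ a ∈ s, insertSign a s * h (s.erase a) = 0) :
    ∑ s, ((W.filter fun a => ∀ b ∈ s, K a b = 0).card : ℝ) * h s ^ 2 =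
      ∑ t, ∑ b, ∑ a, if K a b = 0 then
        (if b ∈ t then 0 else insertSign b t * h (insert b t)) *
        (if a ∈ t then 0 else insertSign a t * h (insert a t)) else 0 := by
  set g : Finset ι → ι → ℝ := fun t a => if a ∈ t then 0 else insertSign a t * h (insert a t)
    with hg
  have gne : ∀ {t a}, g t a ≠ 0 → a ∉ t ∧ h (insert a t) ≠ 0 := by
    intro t a hta
    by_cases hat : a ∈ t
    · simp [hg, hat] at hta
    · refine ⟨hat, fun h0 => hta (by simp [hg, h0])⟩
  set F : Finset ι → ι → ℝ := fun t b =>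
    ∑ a ∈ W.filter (fun a => ∀ c ∈ insert b t, K a c = 0), g t b * g t a with hF
  have h1 : ∀ s, ((W.filter fun a => ∀ b ∈ s, K a b = 0).card : ℝ) * h s ^ 2 =
      ∑ b ∈ s, F (s.erase b) b := by
    intro s
    have hFs : ∑ b ∈ s, F (s.erase b) b =
        ∑ a ∈ W.filter (fun a => ∀ c ∈ s, K a c = 0),
          ∑ b ∈ s, g (s.erase b) b * g (s.erase b) a := by
      rw [Finset.sum_comm]
      refine Finset.sum_congr rfl fun b hb => ?_
      simp only [hF, Finset.insert_erase hb]
    rw [hFs, ← nsmul_eq_mul, ← Finset.sum_const]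
    refine Finset.sum_congr rfl fun a ha => ?_
    rw [Finset.mem_filter] at ha
    obtain ⟨haW, haK⟩ := ha
    have has : a ∉ s := fun has => hpos a (haK a has)
    by_cases hs : h s = 0
    · rw [hs, Finset.sum_eq_zero]
      · simp
      intro b hb
      simp [hg, Finset.insert_erase hb, hs]
    obtain ⟨c1, c2, c3⟩ := hh s hs
    have := hco (insert a s) (by rw [Finset.card_insert_of_notMem has, c1])
      (Finset.insert_subset haW c2) (by
        intro x hx y hy hxy
        rcases Finset.mem_insert.mp hx with hx' | hx' <;>
          rcases Finset.mem_insert.mp hy with hy' | hy'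
        · exact absurd (hx'.trans hy'.symm) hxy
        · rw [hx']; exact haK y hy'
        · rw [hy', hsymm]; exact haK x hx'
        · exact c3 x hx' y hy' hxy)
    rw [Finset.sum_insert has, Finset.erase_insert has, insertSign_insert_self] at this
    have h2 : h s ^ 2 = -∑ b ∈ s, insertSign a s * h s *
        (insertSign b (insert a s) * h ((insert a s).erase b)) := by
      rw [← Finset.mul_sum]
      linear_combination (-(insertSign a s * h s)) * this * (-1) -
        h s ^ 2 * insertSign_mul_self a s
    rw [h2, ← Finset.sum_neg_distrib]
    refine Finset.sum_congr rfl fun b hb => ?_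
    have hab : a ≠ b := fun e => has (e ▸ hb)
    obtain ⟨t, hbt, rfl⟩ : ∃ t, b ∉ t ∧ insert b t = s :=
      ⟨s.erase b, Finset.notMem_erase b s, Finset.insert_erase hb⟩
    have hat : a ∉ t := fun e => has (Finset.mem_insert_of_mem e)
    rw [Finset.erase_insert hbt, Finset.insert_comm a b t, insertSign_insert_self,
      Finset.erase_insert (by simp [hbt, Ne.symm hab])]
    simp only [hg, hat, hbt, if_false]
    linear_combination (-(h (insert b t) * h (insert a t))) * insertSign_swap hab hat hbt
  rw [Finset.sum_congr rfl fun s _ => h1 s, sum_sum_mem_erase F]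
  refine Finset.sum_congr rfl fun t _ => Finset.sum_congr rfl fun b _ => ?_
  by_cases hbz : g t b = 0
  · have : (∑ a, if K a b = 0 then g t b * g t a else 0) = 0 :=
      Finset.sum_eq_zero fun a _ => by simp [hbz]
    rw [this]
    simp [hF, hbz]
  obtain ⟨hbt, hb⟩ := gne hbz
  simp only [hbt, if_false]
  have : ∀ a, (if K a b = 0 then (insertSign b t * h (insert b t)) * g t a else 0) =
      if K a b = 0 then g t b * g t a else 0 := by
    intro a; simp [hg, hbt]
  rw [Finset.sum_congr rfl fun a _ => this a, ← Finset.sum_filter]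
  refine Finset.sum_subset ?_ ?_
  · intro a ha
    simp only [Finset.mem_filter, Finset.mem_univ, true_and] at ha ⊢
    exact ha.2 b (Finset.mem_insert_self b t)
  · intro a ha hna
    simp only [Finset.mem_filter, Finset.mem_univ, true_and] at ha hna
    by_contra hne
    obtain ⟨hat, hga⟩ := gne (right_ne_zero_of_mul hne)
    obtain ⟨-, c2, c3⟩ := hh _ hga
    refine hna ⟨c2 (Finset.mem_insert_self a t), fun c hc => ?_⟩
    rcases Finset.mem_insert.mp hc with rfl | hc
    · exact ha
    · exact c3 a (Finset.mem_insert_self a t) c (Finset.mem_insert_of_mem hc)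
        (fun e => hat (e ▸ hc))

/-- Harmonic chains vanish when the ground set is large compared with the row sums of `K`. -/
lemma harmonic_eq_zero (hsymm : ∀ a b, K a b = K b a)
    (hpos : ∀ a, K a a ≠ 0) (hone : ∀ a b, K a b ≠ 0 → 1 ≤ K a b)
    (hpsd : ∀ u : ι → ℝ, 0 ≤ ∑ a, ∑ b, K a b * (u a * u b))
    {B : ℝ} (hB : ∀ a, ∑ b ∈ W, K a b ≤ B) (hW : m * B < W.card)
    {h : Finset ι → ℝ} (hh : h ∈ orthogonalChains K W m)
    (hbd : signedBoundary (fun _ => 1) h = 0)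
    (hco : ∀ s : Finset ι, s.card = m + 1 → s ⊆ W →
      (∀ a ∈ s, ∀ b ∈ s, a ≠ b → K a b = 0) →
      ∑ a ∈ s, insertSign a s * h (s.erase a) = 0) : h = 0 := by
  have hbochner := sum_degree_mul_sq hsymm hpos hh hco
  set g : Finset ι → ι → ℝ := fun t a => if a ∈ t then 0 else insertSign a t * h (insert a t)
    with hg
  have hgW : ∀ t a, a ∉ W → g t a = 0 := by
    intro t a ha
    by_contra hne
    by_cases hat : a ∈ t
    · simp [hg, hat] at hne
    simp only [hg, hat, if_false] at hne
    exact ha ((hh _ (right_ne_zero_of_mul hne)).2.1 (Finset.mem_insert_self a t))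
  have hsum : ∀ t, ∑ a, g t a = 0 := by
    intro t
    have := congrFun hbd t
    rw [signedBoundary_apply] at this
    simpa [hg] using this
  set w : ι → ι → ℝ := fun a b => if K a b = 0 then 0 else K a b - 1 with hw
  have hw0 : ∀ a b, 0 ≤ w a b := by
    intro a b
    simp only [hw]
    split_ifs with h0
    · exact le_rfl
    · linarith [hone a b h0]
  have hws : ∀ a b, w a b = w b a := by intro a b; simp only [hw, hsymm a b]
  have hle : ∀ t, (∑ b, ∑ a, if K a b = 0 then g t b * g t a else 0) ≤
      ∑ b, if b ∈ t then 0 else (∑ a ∈ W, w b a) * h (insert b t) ^ 2 := by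
    intro t
    have e1 : (∑ b, ∑ a, if K a b = 0 then g t b * g t a else 0) =
        ∑ b, ∑ a, w b a * (g t b * g t a) - ∑ b, ∑ a, K b a * (g t b * g t a) := by
      have : (∑ b, ∑ a, g t b * g t a) = 0 := by
        rw [← Finset.sum_mul_sum, hsum]; simp
      suffices (∑ b, ∑ a, if K a b = 0 then g t b * g t a else 0) +
          ∑ b, ∑ a, K b a * (g t b * g t a) =
          ∑ b, ∑ a, w b a * (g t b * g t a) + ∑ b, ∑ a, g t b * g t a by linarith
      simp only [← Finset.sum_add_distrib]
      refine Finset.sum_congr rfl fun b _ => Finset.sum_congr rfl fun a _ => ?_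
      simp only [hw, hsymm b a]
      split_ifs with h0
      · rw [h0]; ring
      · ring
    have e2 : ∑ b, ∑ a, w b a * (g t b * g t a) ≤
        ∑ b, ∑ a ∈ W, w b a * g t b ^ 2 := by
      have r1 : ∑ b, ∑ a, w b a * (g t b * g t a) =
          ∑ b ∈ W, ∑ a ∈ W, w b a * (g t b * g t a) := by
        symm
        rw [Finset.sum_subset (Finset.subset_univ W)
          (fun b _ hb => by simp [hgW t b hb])]
        refine Finset.sum_congr rfl fun b _ => ?_
        exact Finset.sum_subset (Finset.subset_univ W) (fun a _ ha => by simp [hgW t a ha])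
      have r2 : ∑ b, ∑ a ∈ W, w b a * g t b ^ 2 = ∑ b ∈ W, ∑ a ∈ W, w b a * g t b ^ 2 := by
        symm
        exact Finset.sum_subset (Finset.subset_univ W) (fun b _ hb => by simp [hgW t b hb])
      have r3 : ∑ b ∈ W, ∑ a ∈ W, w b a * g t b ^ 2 = ∑ b ∈ W, ∑ a ∈ W, w b a * g t a ^ 2 := by
        rw [Finset.sum_comm]
        refine Finset.sum_congr rfl fun b _ => Finset.sum_congr rfl fun a _ => ?_
        rw [hws]
      have r4 : 2 * ∑ b ∈ W, ∑ a ∈ W, w b a * (g t b * g t a) ≤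
          ∑ b ∈ W, ∑ a ∈ W, w b a * g t b ^ 2 + ∑ b ∈ W, ∑ a ∈ W, w b a * g t a ^ 2 := by
        simp only [Finset.mul_sum, ← Finset.sum_add_distrib]
        refine Finset.sum_le_sum fun b _ => Finset.sum_le_sum fun a _ => ?_
        nlinarith [mul_nonneg (hw0 b a) (sq_nonneg (g t b - g t a))]
      rw [r1, r2]; linarith
    have e3 : ∑ b, ∑ a ∈ W, w b a * g t b ^ 2 =
        ∑ b, if b ∈ t then 0 else (∑ a ∈ W, w b a) * h (insert b t) ^ 2 := by
      refine Finset.sum_congr rfl fun b _ => ?_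
      rw [← Finset.sum_mul]
      by_cases hbt : b ∈ t
      · simp [hg, hbt]
      · simp only [hg, hbt, if_false]
        rw [mul_pow, pow_two (insertSign b t), insertSign_mul_self, one_mul]
    have := hpsd (g t)
    linarith
  have hmain : ∑ s, ((W.filter fun a => ∀ b ∈ s, K a b = 0).card : ℝ) * h s ^ 2 ≤
      ∑ s, ∑ b ∈ s, (∑ a ∈ W, w b a) * h s ^ 2 := by
    rw [hbochner]
    refine (Finset.sum_le_sum fun t _ => hle t).trans_eq ?_
    rw [← sum_sum_mem_erase (fun t b => (∑ a ∈ W, w b a) * h (insert b t) ^ 2)]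
    refine Finset.sum_congr rfl fun s _ => Finset.sum_congr rfl fun b hb => ?_
    rw [Finset.insert_erase hb]
  have hdeg : ∀ s : Finset ι, (W.card : ℝ) ≤
      ((W.filter fun a => ∀ b ∈ s, K a b = 0).card : ℝ) +
        ∑ b ∈ s, ((W.filter fun a => K b a ≠ 0).card : ℝ) := by
    intro s
    rw [← Finset.card_filter_add_card_filter_not (s := W) (fun a => ∀ b ∈ s, K a b = 0)]
    push_cast
    gcongr
    have : (W.filter fun a => ¬ ∀ b ∈ s, K a b = 0) ⊆
        s.biUnion fun b => W.filter fun a => K b a ≠ 0 := by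
      intro a ha
      simp only [Finset.mem_filter, not_forall, Finset.mem_biUnion] at ha ⊢
      obtain ⟨haW, b, hb, hab⟩ := ha
      exact ⟨b, hb, haW, by rwa [hsymm]⟩
    exact_mod_cast (Finset.card_le_card this).trans Finset.card_biUnion_le
  have hrow : ∀ b, ((W.filter fun a => K b a ≠ 0).card : ℝ) + ∑ a ∈ W, w b a ≤ B := by
    intro b
    refine le_trans (le_of_eq ?_) (hB b)
    rw [Finset.card_filter]
    push_cast
    rw [← Finset.sum_add_distrib]
    refine Finset.sum_congr rfl fun a _ => ?_
    simp only [hw]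
    by_cases h0 : K b a = 0 <;> simp [h0]
  have hfinal : ∑ s, (W.card - m * B) * h s ^ 2 ≤ 0 := by
    rw [← sub_nonpos, ← Finset.sum_sub_distrib] at hmain
    refine le_trans (Finset.sum_le_sum fun s _ => ?_) hmain
    by_cases hs : h s = 0
    · simp [hs]
    rw [← Finset.sum_mul, ← sub_mul]
    refine mul_le_mul_of_nonneg_right ?_ (sq_nonneg _)
    have h1 := hdeg s
    have h2 : ∑ b ∈ s, (((W.filter fun a => K b a ≠ 0).card : ℝ) + ∑ a ∈ W, w b a) ≤
        ∑ _b ∈ s, B := Finset.sum_le_sum fun b _ => hrow b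
    rw [Finset.sum_const, (hh s hs).1, nsmul_eq_mul, Finset.sum_add_distrib] at h2
    linarith
  have hc : 0 < (W.card : ℝ) - m * B := by linarith
  have hz := (Finset.sum_eq_zero_iff_of_nonneg
    (fun s _ => mul_nonneg hc.le (sq_nonneg (h s)))).mp
    (le_antisymm hfinal (Finset.sum_nonneg fun s _ => mul_nonneg hc.le (sq_nonneg (h s))))
  ext s
  simpa [hc.ne'] using hz s (Finset.mem_univ s)

/-- The complex of orthogonal subsets of `W` is acyclic in the degrees below
`W.card / B`. -/
lemma exists_signedBoundary_eq (hsymm : ∀ a b, K a b = K b a)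
    (hpos : ∀ a, K a a ≠ 0) (hone : ∀ a b, K a b ≠ 0 → 1 ≤ K a b)
    (hpsd : ∀ u : ι → ℝ, 0 ≤ ∑ a, ∑ b, K a b * (u a * u b))
    {B : ℝ} (hB : ∀ a, ∑ b ∈ W, K a b ≤ B) (hW : m * B < W.card)
    {x : Finset ι → ℝ} (hx : x ∈ orthogonalChains K W m)
    (hbd : signedBoundary (fun _ => 1) x = 0) :
    ∃ y ∈ orthogonalChains K W (m + 1), signedBoundary (fun _ => 1) y = x := by
  let e := WithLp.linearEquiv 2 ℝ (Finset ι → ℝ)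
  let S : Submodule ℝ (EuclideanSpace ℝ (Finset ι)) :=
    ((orthogonalChains K W (m + 1)).map (signedBoundary fun _ => 1)).map e.symm.toLinearMap
  obtain ⟨k, hk, z, hz, hkz⟩ := S.exists_add_mem_mem_orthogonal (e.symm x)
  obtain ⟨-, ⟨y, hy, rfl⟩, rfl⟩ := hk
  have hxz : x = signedBoundary (fun _ => 1) y + e z := by
    have := congrArg e hkz
    simpa using this
  refine ⟨y, hy, ?_⟩
  suffices e z = 0 by rw [hxz, this, add_zero]
  have hez : e z = x - signedBoundary (fun _ => 1) y := by rw [hxz]; simp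
  refine harmonic_eq_zero hsymm hpos hone hpsd hB hW ?_ ?_ ?_
  · rw [hez]; exact Submodule.sub_mem _ hx (signedBoundary_mem_orthogonalChains hy)
  · rw [hez, map_sub, hbd, signedBoundary_self, sub_zero]
  · intro s hs hsW hsK
    have hsingle : (Pi.single s 1 : Finset ι → ℝ) ∈ orthogonalChains K W (m + 1) := by
      intro s' hs'
      have : s' = s := by by_contra hne; simp [hne] at hs'
      subst this; exact ⟨hs, hsW, hsK⟩
    have hin := hz (e.symm (signedBoundary (fun _ => 1) (Pi.single s 1)))
      ⟨_, ⟨_, hsingle, rfl⟩, rfl⟩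
    rw [PiLp.inner_apply] at hin
    have hval : ∀ t, (e.symm (signedBoundary (fun _ => (1 : ℝ)) (Pi.single s (1 : ℝ)))) t =
      signedBoundary (fun _ => (1 : ℝ)) (Pi.single s (1 : ℝ)) t := fun _ => rfl
    have hz' : ∀ t, z t = e z t := fun _ => rfl
    simp only [hval, hz', signedBoundary_apply, RCLike.inner_apply, conj_trivial,
      Finset.mul_sum] at hin
    rw [← hin]
    have := sum_sum_mem_erase (fun t b => e z t *
      ((1 * insertSign b t) • (Pi.single s (1 : ℝ) : Finset ι → ℝ) (insert b t)))
    have h2 : ∀ (t : Finset ι) (b : ι), e z t * (if b ∈ t then 0 else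
        (1 * insertSign b t) • (Pi.single s (1 : ℝ) : Finset ι → ℝ) (insert b t)) =
        if b ∈ t then 0 else e z t *
      ((1 * insertSign b t) • (Pi.single s (1 : ℝ) : Finset ι → ℝ) (insert b t)) := by
      intro t b; split_ifs <;> simp
    simp only [h2]
    rw [← this, Finset.sum_eq_single s]
    · refine Finset.sum_congr rfl fun b hb => ?_
      rw [Finset.insert_erase hb, ← insertSign_insert_self b (s.erase b), Finset.insert_erase hb]
      simp [mul_comm]
    · intro s' _ hne
      refine Finset.sum_eq_zero fun b hb => ?_
      rw [Finset.insert_erase hb]; simp [hne]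
    · simp

end Acyclicity

section Rainbow

variable {ι : Type} [LinearOrder ι] [Fintype ι] {K : ι → ι → ℝ}

/-- Filling in boundaries degree by degree yields a compatible family of chains indexed by
the sets of forbidden colors. -/
lemma exists_compatible_chains {κ : Type} [LinearOrder κ] [Fintype κ] (c : ι → κ)
    (hsymm : ∀ a b, K a b = K b a)
    (hpos : ∀ a, K a a ≠ 0) (hone : ∀ a b, K a b ≠ 0 → 1 ≤ K a b)
    (hpsd : ∀ u : ι → ℝ, 0 ≤ ∑ a, ∑ b, K a b * (u a * u b))
    {B : ℝ} (hB : ∀ (J : Finset κ) (a : ι), ∑ b with c b ∉ J, K a b ≤ B)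
    (hW : ∀ (J : Finset κ) (m : ℕ), Jᶜ.card = m + 1 →
      m * B < (Finset.univ.filter fun a => c a ∉ J).card) :
    ∃ y : Finset κ → Finset ι → ℝ, y Finset.univ = Pi.single ∅ 1 ∧ ∀ J,
      y J ∈ orthogonalChains K (Finset.univ.filter fun a => c a ∉ J) Jᶜ.card ∧
      signedBoundary (fun _ => 1) (y J) = signedBoundary (fun _ => 1) y J := by
  suffices H : ∀ m : ℕ, ∃ y : Finset κ → Finset ι → ℝ, y Finset.univ = Pi.single ∅ 1 ∧
      ∀ J, Jᶜ.card ≤ m →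
        y J ∈ orthogonalChains K (Finset.univ.filter fun a => c a ∉ J) Jᶜ.card ∧
        signedBoundary (fun _ => 1) (y J) = signedBoundary (fun _ => 1) y J by
    obtain ⟨y, h1, h2⟩ := H (Fintype.card κ)
    exact ⟨y, h1, fun J => h2 J (Finset.card_le_univ _)⟩
  intro m
  induction m with
  | zero =>
    refine ⟨fun _ => Pi.single ∅ 1, rfl, fun J hJ => ?_⟩
    have hJu : J = Finset.univ := by simpa using hJ
    subst hJu
    refine ⟨fun s hs => ?_, ?_⟩
    · have : s = ∅ := by by_contra hne; simp [hne] at hs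
      subst this; simp
    · ext s
      simp [signedBoundary_apply]
  | succ m ih =>
    obtain ⟨y, hy0, hy⟩ := ih
    have hfill : ∀ J : Finset κ, Jᶜ.card = m + 1 → ∃ z ∈ orthogonalChains K
        (Finset.univ.filter fun a => c a ∉ J) (m + 1),
        signedBoundary (fun _ => 1) z = signedBoundary (fun _ => 1) y J := by
      intro J hJ
      have hins : ∀ i ∉ J, (insert i J)ᶜ.card = m := by
        intro i hi
        rw [Finset.compl_insert, Finset.card_erase_of_mem (by simpa using hi), hJ]; rfl
      refine exists_signedBoundary_eq hsymm hpos hone hpsd (hB J) (hW J m hJ) ?_ ?_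
      · rw [signedBoundary_apply]
        refine Submodule.sum_mem _ fun i _ => ?_
        split_ifs with hi
        · exact Submodule.zero_mem _
        · refine Submodule.smul_mem _ _ ?_
          have := (hy (insert i J) (hins i hi).le).1
          rw [hins i hi] at this
          refine orthogonalChains_mono (fun a ha => ?_) m this
          simp only [Finset.mem_filter, Finset.mem_univ, true_and, Finset.mem_insert,
            not_or] at ha ⊢
          exact ha.2
      · rw [← Pi.zero_apply (M := fun _ : Finset κ => Finset ι → ℝ) J,
          ← signedBoundary_self (fun _ => 1) y, signedBoundary_apply _ y,
          signedBoundary_apply _ (signedBoundary _ y), map_sum]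
        refine Finset.sum_congr rfl fun i _ => ?_
        split_ifs with hi
        · simp
        · rw [map_smul, (hy _ (hins i hi).le).2]
    choose! z hz hz' using hfill
    have hext : ∀ J : Finset κ, Jᶜ.card ≤ m + 1 →
        signedBoundary (fun _ => (1 : ℝ)) (fun J => if Jᶜ.card = m + 1 then z J else y J) J =
          signedBoundary (fun _ => 1) y J := by
      intro J hJ
      rw [signedBoundary_apply, signedBoundary_apply]
      refine Finset.sum_congr rfl fun i _ => ?_
      split_ifs with hi hc
      · rfl
      · exfalso
        rw [Finset.compl_insert, Finset.card_erase_of_mem (by simpa using hi)] at hc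
        omega
      · rfl
    refine ⟨fun J => if Jᶜ.card = m + 1 then z J else y J, by simp [hy0], fun J hJ => ?_⟩
    rw [hext J hJ]
    by_cases hc : Jᶜ.card = m + 1
    · simp only [hc, if_true]
      exact ⟨hz J hc, hz' J hc⟩
    · simp only [hc, if_false]
      exact hy J (by omega)

variable {n : ℕ}

/-- Successively removing one vertex of each of the colors `k - 1, …, 0`. -/
def rainbowBoundary (c : ι → Fin n) : ℕ → (Finset ι → ℝ) →ₗ[ℝ] (Finset ι → ℝ)
  | 0 => LinearMap.id
  | k + 1 => rainbowBoundary c k ∘ₗ signedBoundary fun a => if (c a : ℕ) = k then 1 else 0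

lemma exists_rainbow_of_rainbowBoundary (c : ι → Fin n) {k : ℕ} {x : Finset ι → ℝ}
    (h : rainbowBoundary c k x ≠ 0) :
    ∃ s, x s ≠ 0 ∧ ∀ j < k, ∃ a ∈ s, (c a : ℕ) = j := by
  induction k generalizing x with
  | zero =>
    obtain ⟨s, hs⟩ := Function.ne_iff.mp h
    exact ⟨s, hs, by simp⟩
  | succ k ih =>
    obtain ⟨s, hs, hsk⟩ := ih h
    obtain ⟨a, -, hak, hx⟩ := exists_insert_ne_zero_of_signedBoundary hs
    refine ⟨insert a s, hx, fun j hj => ?_⟩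
    rcases Nat.lt_succ_iff_lt_or_eq.mp hj with hj | rfl
    · obtain ⟨b, hb, hbj⟩ := hsk j hj
      exact ⟨b, Finset.mem_insert_of_mem hb, hbj⟩
    · exact ⟨a, Finset.mem_insert_self a s, by simpa using hak⟩

lemma rainbowBoundary_signedBoundary (c : ι → Fin n) {j k : ℕ} (hj : j < k)
    (x : Finset ι → ℝ) :
    rainbowBoundary c k (signedBoundary (fun a => if (c a : ℕ) = j then 1 else 0) x) = 0 := by
  induction k generalizing x with
  | zero => simp at hj
  | succ k ih =>
    rw [rainbowBoundary, LinearMap.comp_apply]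
    rcases Nat.lt_succ_iff_lt_or_eq.mp hj with hj | rfl
    · rw [signedBoundary_anticomm, map_neg, ih hj, neg_zero]
    · rw [signedBoundary_self, map_zero]

/-- A rainbow orthogonal set exists if every union of color classes is large compared with
the row sums of the Gram-type matrix `K`. -/
lemma exists_rainbow_orthogonal (c : ι → Fin n)
    (hsymm : ∀ a b, K a b = K b a)
    (hpos : ∀ a, K a a ≠ 0) (hone : ∀ a b, K a b ≠ 0 → 1 ≤ K a b)
    (hpsd : ∀ u : ι → ℝ, 0 ≤ ∑ a, ∑ b, K a b * (u a * u b))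
    {B : ℝ} (hB : ∀ (J : Finset (Fin n)) (a : ι), ∑ b with c b ∉ J, K a b ≤ B)
    (hW : ∀ (J : Finset (Fin n)) (m : ℕ), Jᶜ.card = m + 1 →
      m * B < (Finset.univ.filter fun a => c a ∉ J).card) :
    ∃ f : Fin n → ι, (∀ i, c (f i) = i) ∧ ∀ i j, i ≠ j → K (f i) (f j) = 0 := by
  obtain ⟨y, hy0, hy⟩ := exists_compatible_chains c hsymm hpos hone hpsd hB hW
  have hcolor : ∀ (J : Finset (Fin n)) s, y J s ≠ 0 → ∀ a ∈ s, c a ∉ J := by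
    intro J s hs a ha
    simpa using ((hy J).1 s hs).2.1 ha
  have hne : ∀ k ≤ n, rainbowBoundary c k (y (Finset.univ.filter fun i => k ≤ (i : ℕ))) ≠ 0 := by
    intro k
    induction k with
    | zero =>
      intro _ h0
      have := congrFun h0 ∅
      simp [rainbowBoundary, hy0] at this
    | succ k ih =>
      intro hk h0
      refine ih (by omega) ?_
      set J := Finset.univ.filter fun i : Fin n => k + 1 ≤ (i : ℕ) with hJ
      have hone_eq : (fun _ : ι => (1 : ℝ)) =
          ∑ j : Fin n, fun a => if (c a : ℕ) = (j : ℕ) then 1 else 0 := by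
        ext a
        simp [Finset.sum_apply, ← Fin.ext_iff]
      have hleft : rainbowBoundary c k (signedBoundary (fun _ => 1) (y J)) = 0 := by
        rw [hone_eq, signedBoundary_sum, map_sum]
        refine Finset.sum_eq_zero fun j _ => ?_
        rcases lt_trichotomy (j : ℕ) k with hjk | hjk | hjk
        · exact rainbowBoundary_signedBoundary c hjk _
        · rw [hjk]; exact h0
        · rw [show signedBoundary (fun a => if (c a : ℕ) = (j : ℕ) then (1 : ℝ) else 0) (y J) = 0
            from ?_, map_zero]
          ext s
          by_contra hs
          obtain ⟨a, -, haj, hya⟩ := exists_insert_ne_zero_of_signedBoundary hs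
          refine hcolor J _ hya a (Finset.mem_insert_self a s) ?_
          have : (c a : ℕ) = j := by simpa using haj
          simp only [hJ, Finset.mem_filter, Finset.mem_univ, true_and]
          omega
      rw [(hy J).2, signedBoundary_apply, map_sum, Finset.sum_eq_single ⟨k, by omega⟩] at hleft
      · have hkJ : (⟨k, by omega⟩ : Fin n) ∉ J := by simp [hJ]
        rw [if_neg hkJ, map_smul] at hleft
        have hJk : insert (⟨k, by omega⟩ : Fin n) J =
            Finset.univ.filter fun i : Fin n => k ≤ (i : ℕ) := by
          ext i
          simp only [hJ, Finset.mem_insert, Finset.mem_filter, Finset.mem_univ, true_and,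
            Fin.ext_iff]
          omega
        rw [hJk] at hleft
        refine (smul_eq_zero.mp hleft).resolve_left ?_
        rw [one_mul]
        exact left_ne_zero_of_mul_eq_one (insertSign_mul_self _ _)
      · intro i _ hi
        by_cases hiJ : i ∈ J
        · simp [hiJ]
        rw [if_neg hiJ, map_smul]
        have hik : (i : ℕ) < k := by
          simp only [hJ, Finset.mem_filter, Finset.mem_univ, true_and] at hiJ
          have : (i : ℕ) ≠ k := fun e => hi (Fin.ext e)
          omega
        have : rainbowBoundary c k (y (insert i J)) = 0 := by
          by_contra hne
          obtain ⟨s, hs, hsk⟩ := exists_rainbow_of_rainbowBoundary c hne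
          obtain ⟨a, ha, hai⟩ := hsk i hik
          refine hcolor _ s hs a ha ?_
          rw [Fin.ext hai]
          exact Finset.mem_insert_self i J
        rw [this, smul_zero]
      · simp
  obtain ⟨s, hs, hsn⟩ := exists_rainbow_of_rainbowBoundary c (hne n le_rfl)
  have hex : ∀ i : Fin n, ∃ a ∈ s, c a = i := by
    intro i
    obtain ⟨a, ha, hai⟩ := hsn i i.2
    exact ⟨a, ha, Fin.ext hai⟩
  choose f hfs hfc using hex
  refine ⟨f, hfc, fun i j hij => ?_⟩
  exact ((hy _).1 s hs).2.2 _ (hfs i) _ (hfs j) fun e => hij (by rw [← hfc i, ← hfc j, e])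

end Rainbow

/-- If `G` is an `r`-graph with maximum degree `Δ` colored with `n ≥ 2` classes, each of size
at least `⌊(n-1)rΔ/n⌋ + 1`, then there is a full rainbow matching. -/
theorem stmt14 {V ι : Type} [Fintype ι] [DecidableEq V]
    (r Δ n : ℕ) (hr : 1 ≤ r) (hn : 2 ≤ n)
    (E : ι → Finset V) (hcard : ∀ a, (E a).card = r)
    (hdeg : ∀ v, mhDeg E v ≤ Δ)
    (c : ι → Fin n)
    (hsize : ∀ i : Fin n, (n - 1) * r * Δ / n + 1 ≤ classSize c i) :
    hasFullRainbowMatching E c := by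
  let _ : LinearOrder ι := LinearOrder.lift' (Fintype.equivFin ι) (Fintype.equivFin ι).injective
  have hinter : ∀ a b (U : Finset V), E a ⊆ U →
      (E a ∩ E b).card = ∑ v ∈ U, (if v ∈ E a then 1 else 0) * (if v ∈ E b then 1 else 0) := by
    intro a b U hU
    simp only [mul_ite, mul_one, mul_zero, ← ite_and, ← Finset.card_filter]
    congr 1
    ext v
    simp only [Finset.mem_inter, Finset.mem_filter]
    exact ⟨fun h => ⟨hU h.1, h.2, h.1⟩, fun h => ⟨h.2.2, h.2.1⟩⟩
  obtain ⟨f, hf, hfK⟩ := exists_rainbow_orthogonal (K := fun a b => ((E a ∩ E b).card : ℝ))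
    (B := ((r * Δ : ℕ) : ℝ)) c (fun a b => by rw [Finset.inter_comm])
    (fun a => by
      rw [Finset.inter_self, hcard]
      exact_mod_cast (by omega : r ≠ 0))
    (fun a b h => by exact_mod_cast Nat.one_le_iff_ne_zero.mpr (by exact_mod_cast h))
    (fun u => by
      have : ∑ a, ∑ b, ((E a ∩ E b).card : ℝ) * (u a * u b) =
          ∑ v ∈ Finset.univ.biUnion E, (∑ a, (if v ∈ E a then 1 else 0) * u a) ^ 2 := by
        simp only [pow_two, Finset.sum_mul_sum]
        conv_rhs => rw [Finset.sum_comm]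
        refine Finset.sum_congr rfl fun a _ => ?_
        conv_rhs => rw [Finset.sum_comm]
        refine Finset.sum_congr rfl fun b _ => ?_
        rw [hinter a b _ (Finset.subset_biUnion_of_mem E (Finset.mem_univ a))]
        push_cast
        rw [Finset.sum_mul]
        exact Finset.sum_congr rfl fun v _ => by ring
      rw [this]
      exact Finset.sum_nonneg fun v _ => sq_nonneg _)
    (fun J a => by
      norm_cast
      calc ∑ b with c b ∉ J, (E a ∩ E b).card ≤ ∑ b, (E a ∩ E b).card :=
            Finset.sum_le_sum_of_subset (Finset.filter_subset _ _)
        _ = ∑ v ∈ E a, mhDeg E v := by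
            simp only [mhDeg, Finset.card_filter, ← Finset.filter_mem_eq_inter]
            exact Finset.sum_comm
        _ ≤ ∑ _v ∈ E a, Δ := Finset.sum_le_sum fun v _ => hdeg v
        _ = r * Δ := by rw [Finset.sum_const, hcard, smul_eq_mul])
    (fun J m hJ => by
      norm_cast
      have hcount : (Finset.univ.filter fun a => c a ∉ J).card = ∑ i ∈ Jᶜ, classSize c i := by
        rw [Finset.card_eq_sum_card_fiberwise (f := c) (t := Jᶜ) (fun a ha => by simpa using ha)]
        refine Finset.sum_congr rfl fun i hi => ?_
        rw [classSize, Finset.filter_filter]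
        congr 1
        ext a
        simp only [Finset.mem_filter, Finset.mem_univ, true_and, and_iff_right_iff_imp]
        rintro rfl
        simpa using hi
      have hmn : m + 1 ≤ n := hJ ▸ (Finset.card_le_univ Jᶜ).trans_eq (Fintype.card_fin n)
      have hlow : (m + 1) * ((n - 1) * r * Δ / n + 1) ≤
          (Finset.univ.filter fun a => c a ∉ J).card := by
        rw [hcount, ← hJ, ← smul_eq_mul]
        exact Finset.card_nsmul_le_sum _ _ _ fun i _ => hsize i
      have hfloor : (n - 1) * r * Δ < n * ((n - 1) * r * Δ / n + 1) :=
        Nat.lt_mul_div_succ _ (by omega)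
      refine lt_of_lt_of_le ?_ hlow
      generalize (n - 1) * r * Δ / n + 1 = q at hfloor
      obtain ⟨n, rfl⟩ : ∃ k, n = k + 1 := ⟨n - 1, by omega⟩
      rw [Nat.add_sub_cancel, mul_assoc] at hfloor
      generalize r * Δ = B at hfloor
      have hmn' : m ≤ n := by omega
      refine lt_of_mul_lt_mul_left (a := n + 1) ?_ (Nat.zero_le _)
      have h1 : (m + 1) * (n * B) < (m + 1) * ((n + 1) * q) :=
        Nat.mul_lt_mul_of_pos_left hfloor (Nat.succ_pos m)
      have h2 : m * B ≤ n * B := Nat.mul_le_mul_right _ hmn'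
      nlinarith)
  refine ⟨f, hf, fun i j hij => ?_⟩
  have := hfK i j hij
  rw [Finset.disjoint_iff_inter_eq_empty]
  simpa using this
end

section
/- Fix integers r ≥ 1 and s ≥ 2 such that an (r, s)-net exists, and let Δ and n be positive integers with Δ ≡ 0 (mod s), Δ ≥ s, and n ≡ s (mod s(s−1)). Then there exist an r-graph G with maximum degree Δ and an edge-coloring of G into color classes E_1, …, E_n such that |E_i| ≥ ⌊(n−1)rΔ/n⌋ for every i and G has no full rainbow matching with respect to E_1, …, E_n. -/
open Finset

/-- An `(r, s)`-net: an `r`-graph on `r²` vertices with `rs` edges partitioned into `s`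
parallel classes, each a perfect matching of size `r`, such that any two edges from distinct
parallel classes meet in exactly one vertex. -/
def IsNet (r s : ℕ) : Prop :=
  ∃ (E : Fin (r * s) → Finset (Fin (r * r))) (p : Fin (r * s) → Fin s),
    (∀ a, (E a).card = r) ∧
    (∀ i : Fin s, (Finset.univ.filter fun a => p a = i).card = r) ∧
    (∀ a b, a ≠ b → p a = p b → Disjoint (E a) (E b)) ∧
    (∀ (i : Fin s) (v : Fin (r * r)), ∃ a, p a = i ∧ v ∈ E a) ∧
    (∀ a b, p a ≠ p b → (E a ∩ E b).card = 1)


/-- An edge-colored hypergraph of constant degree on arbitrary finite types may be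
transported to index types of the form `Fin m`. -/
theorem exists_fin_model {V ι κ : Type} [Fintype V] [DecidableEq V] [Fintype ι] [Fintype κ]
    [DecidableEq κ] {r D n m : ℕ} (hκ : Fintype.card κ = n) (E : ι → Finset V) (c : ι → κ)
    (hr : ∀ a, (E a).card = r) (hD : ∀ v, mhDeg E v = D) (v₀ : V)
    (hm : ∀ i, m ≤ classSize c i) (hf : ¬ hasFullRainbowMatching E c) :
    ∃ (N M : ℕ) (E : Fin M → Finset (Fin N)) (c : Fin M → Fin n),
      (∀ a, (E a).card = r) ∧
      (∀ v, mhDeg E v ≤ D) ∧ (∃ v, mhDeg E v = D) ∧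
      (∀ i : Fin n, m ≤ classSize c i) ∧
      ¬ hasFullRainbowMatching E c := by
  classical
  let eV := Fintype.equivFin V
  let eι := Fintype.equivFin ι
  let eκ := Fintype.equivFinOfCardEq hκ
  have hdeg : ∀ v, mhDeg (fun a => (E (eι.symm a)).map eV.toEmbedding) v = D := by
    intro v
    rw [← hD (eV.symm v)]
    refine Finset.card_equiv eι.symm fun a => ?_
    simp [Finset.mem_map_equiv]
  refine ⟨_, _, fun a => (E (eι.symm a)).map eV.toEmbedding, fun a => eκ (c (eι.symm a)),
    fun a => by simp [hr], fun v => (hdeg v).le, ⟨eV v₀, hdeg _⟩, fun i => ?_, ?_⟩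
  · refine (hm (eκ.symm i)).trans (le_of_eq ?_)
    refine Finset.card_equiv eι fun a => ?_
    simp [Equiv.eq_symm_apply]
  · rintro ⟨f, hfc, hfd⟩
    refine hf ⟨fun y => eι.symm (f (eκ y)), fun y => eκ.injective (hfc (eκ y)), fun y z hyz => ?_⟩
    have := hfd (eκ y) (eκ z) (eκ.injective.ne hyz)
    exact (Finset.disjoint_map _).1 this

/-- The color of an edge available to the colors of level at least `l` in branch `b`: if `q`
holds it is the color `j` of level `l`, and otherwise it is the final color of the branch. -/
def poolColor {t k : ℕ} (b : Fin (t + 1)) (l : ℕ) (j : Fin t) (q : Prop) [Decidable q] :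
    Fin (t + 1) × Option (Fin k × Fin t) :=
  if h : l < k ∧ q then (b, some (⟨l, h.1⟩, j)) else (b, none)

/-- The coloring of the `(t + 1)`-ary tree of nets. The nets at the root are `(j, none)` and the
nets at level `l` of branch `b` are `(j, some (b, l))`. Here `cls` gives the parallel class of an
edge inside a net. -/
def netColor {X : Type} [DecidableEq X] {t k : ℕ} (cls : X → Fin (t + 1)) (S : Finset X) :
    (Fin t × Option (Fin (t + 1) × Fin k)) × X → Fin (t + 1) × Option (Fin k × Fin t)
  | ((j, none), x) => poolColor (cls x) 0 j (x ∈ S)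
  | ((j, some (b, l)), x) =>
      Fin.lastCases (motive := fun _ => Fin (t + 1) × Option (Fin k × Fin t))
        (poolColor b (l + 1) j (x ∈ S)) (fun i => (b, some (l, i))) (cls x)

theorem poolColor_fst {t k : ℕ} (b : Fin (t + 1)) (l : ℕ) (j : Fin t) (q : Prop) [Decidable q] :
    (poolColor (k := k) b l j q).1 = b := by
  unfold poolColor; split_ifs <;> rfl

theorem poolColor_eq_some {t k : ℕ} {b b' : Fin (t + 1)} {l : ℕ} {j j' : Fin t} {l' : Fin k}
    {q : Prop} [Decidable q] :
    poolColor b l j q = (b', some (l', j')) ↔ b = b' ∧ l = l' ∧ j = j' ∧ q := by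
  unfold poolColor
  split_ifs with h
  · simp only [Prod.mk.injEq, Option.some.injEq, Fin.ext_iff]
    tauto
  · simp only [Prod.mk.injEq, reduceCtorEq, and_false, false_iff]
    rintro ⟨-, rfl, -, hq⟩
    exact h ⟨l'.2, hq⟩

theorem poolColor_eq_none {t k : ℕ} {b b' : Fin (t + 1)} {l : ℕ} {j : Fin t}
    {q : Prop} [Decidable q] :
    poolColor (k := k) b l j q = (b', none) ↔ b = b' ∧ (l < k → ¬ q) := by
  unfold poolColor
  split_ifs with h
  · simp only [Prod.mk.injEq, reduceCtorEq, and_false, false_iff]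
    tauto
  · simp only [Prod.mk.injEq, and_true]
    tauto

theorem classSize_prod {A X κ : Type} [Fintype A] [Fintype X] [DecidableEq κ] (c : A × X → κ)
    (y : κ) : classSize c y = ∑ a, (univ.filter fun x => c (a, x) = y).card := by
  simp only [classSize, Finset.card_filter]
  exact Fintype.sum_prod_type _

section netColor

variable {X : Type} [DecidableEq X] {t k : ℕ} {cls : X → Fin (t + 1)} {S : Finset X}

theorem netColor_root (j : Fin t) (x : X) :
    netColor (k := k) cls S ((j, none), x) = poolColor (cls x) 0 j (x ∈ S) := rfl

theorem netColor_last {j : Fin t} {b : Fin (t + 1)} {l : Fin k} {x : X}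
    (hx : cls x = Fin.last t) :
    netColor cls S ((j, some (b, l)), x) = poolColor b (l + 1) j (x ∈ S) := by
  simp [netColor, hx]

theorem netColor_castSucc {j i : Fin t} {b : Fin (t + 1)} {l : Fin k} {x : X}
    (hx : cls x = i.castSucc) :
    netColor cls S ((j, some (b, l)), x) = (b, some (l, i)) := by
  simp [netColor, hx]

/-- If the chosen edges inside each net lie in a common parallel class, then it is impossible to
choose one edge of each color. -/
theorem netColor_no_transversal
    (f : Fin (t + 1) × Option (Fin k × Fin t) → (Fin t × Option (Fin (t + 1) × Fin k)) × X)
    (hf : ∀ y, netColor cls S (f y) = y)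
    (hcls : ∀ y z, (f y).1 = (f z).1 → cls (f y).2 = cls (f z).2) : False := by
  classical
  obtain ⟨b, hb⟩ : ∃ b, ∀ j y, (f y).1 = (j, none) → cls (f y).2 ≠ b := by
    by_contra! h
    choose j y h1 h2 using h
    have : Function.Injective j := fun b b' hbb => by
      rw [← h2 b, ← h2 b']
      exact hcls _ _ (by rw [h1, h1, hbb])
    simpa using Fintype.card_le_of_injective j this
  have key : ∀ l : ℕ, ∀ hl : l < k, ∀ j y, (f y).1 = (j, some (b, ⟨l, hl⟩)) →
      cls (f y).2 ≠ Fin.last t := by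
    intro l
    induction l using Nat.strong_induction_on with
    | _ l ih =>
      intro hl
      have serve : ∀ i : Fin t, ∃ j, (f (b, some (⟨l, hl⟩, i))).1 = (j, some (b, ⟨l, hl⟩)) ∧
          cls (f (b, some (⟨l, hl⟩, i))).2 = i.castSucc := by
        intro i
        have h := hf (b, some (⟨l, hl⟩, i))
        have hb' := fun j => hb j (b, some (⟨l, hl⟩, i))
        have ih' := fun m hm hm' j => ih m hm hm' j (b, some (⟨l, hl⟩, i))
        rcases hfy : f (b, some (⟨l, hl⟩, i)) with ⟨⟨j, _ | ⟨b', l'⟩⟩, x⟩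
        · rw [hfy] at h hb'
          rw [netColor_root, poolColor_eq_some] at h
          exact absurd h.1 (hb' j rfl)
        · rw [hfy] at h ih'
          rcases Fin.eq_castSucc_or_eq_last (cls x) with ⟨i', hi'⟩ | hlast
          · rw [netColor_castSucc hi'] at h
            simp only [Prod.mk.injEq, Option.some.injEq] at h
            obtain ⟨rfl, rfl, rfl⟩ := h
            exact ⟨j, rfl, hi'⟩
          · rw [netColor_last hlast, poolColor_eq_some] at h
            obtain ⟨rfl, hl', -, -⟩ := h
            exact absurd hlast (ih' l' (by simp at hl'; omega) l'.2 j rfl)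
      choose g hg1 hg2 using serve
      have ginj : Function.Injective g := fun i i' hii => by
        apply Fin.castSucc_injective
        rw [← hg2, ← hg2]
        exact hcls _ _ (by rw [hg1, hg1, hii])
      intro j y hy
      obtain ⟨i, rfl⟩ := Finite.surjective_of_injective ginj j
      rw [hcls y _ (hy.trans (hg1 i).symm), hg2]
      exact (Fin.castSucc_lt_last i).ne
  have h := hf (b, none)
  have hb' := fun j => hb j (b, none)
  have key' := fun l hl j => key l hl j (b, none)
  rcases hfy : f (b, none) with ⟨⟨j, _ | ⟨b', l'⟩⟩, x⟩
  · rw [hfy] at h hb'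
    rw [netColor_root, poolColor_eq_none] at h
    exact hb' j rfl h.1
  · rw [hfy] at h key'
    rcases Fin.eq_castSucc_or_eq_last (cls x) with ⟨i', hi'⟩ | hlast
    · rw [netColor_castSucc hi'] at h
      simp at h
    · rw [netColor_last hlast, poolColor_eq_none] at h
      obtain ⟨rfl, -⟩ := h
      exact key' l' l'.2 j rfl hlast

variable [Fintype X]

/-- If all parallel classes have `U` edges of which `c` lie outside `S`, then a color which is not
the final color of its branch has at least `t * U + (U - c)` edges. -/
theorem le_classSize_some {U c : ℕ} (hU : ∀ i, (univ.filter fun x => cls x = i).card = U)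
    (hS : ∀ i, (univ.filter fun x => cls x = i ∧ x ∈ S).card = U - c)
    (b : Fin (t + 1)) (l : Fin k) (i : Fin t) :
    t * U + (U - c) ≤ classSize (netColor (k := k) cls S) (b, some (l, i)) := by
  classical
  rw [classSize_prod]
  obtain ⟨o, ho, hoc⟩ : ∃ o : Option (Fin (t + 1) × Fin k), o ≠ some (b, l) ∧
      U - c ≤ (univ.filter fun x =>
        netColor (k := k) cls S ((i, o), x) = (b, some (l, i))).card := by
    obtain ⟨_ | l, hl⟩ := l
    · refine ⟨none, by simp, ?_⟩
      rw [← hS b]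
      refine Finset.card_le_card fun x => ?_
      simp only [mem_filter, mem_univ, true_and, netColor_root, poolColor_eq_some]
      tauto
    · refine ⟨some (b, ⟨l, by omega⟩), by simp, ?_⟩
      rw [← hS (Fin.last t)]
      refine Finset.card_le_card fun x => ?_
      simp only [mem_filter, mem_univ, true_and]
      rintro ⟨h1, h2⟩
      rw [netColor_last h1, poolColor_eq_some]
      exact ⟨rfl, rfl, rfl, h2⟩
  have hmain : ∀ j : Fin t, U ≤ (univ.filter fun x =>
      netColor (k := k) cls S ((j, some (b, l)), x) = (b, some (l, i))).card := by
    intro j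
    rw [← hU i.castSucc]
    refine Finset.card_le_card fun x => ?_
    simp only [mem_filter, mem_univ, true_and]
    exact netColor_castSucc
  have hsum : t * U ≤ ∑ a ∈ univ ×ˢ {some (b, l)}, (univ.filter fun x =>
      netColor (k := k) cls S (a, x) = (b, some (l, i))).card := by
    rw [Finset.sum_product]
    simpa using Finset.card_nsmul_le_sum univ _ U fun j _ => hmain j
  calc t * U + (U - c) ≤ _ := Nat.add_le_add hsum hoc
    _ = ∑ a ∈ insert (i, o) (univ ×ˢ {some (b, l)}), _ := by
      rw [Finset.sum_insert (by simpa using ho.symm), add_comm]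
    _ ≤ _ := Finset.sum_le_sum_of_subset (Finset.subset_univ _)

/-- If all parallel classes have `U` edges of which `c` lie outside `S`, then the final color of a
branch has at least `t * (k * c + U)` edges. -/
theorem le_classSize_none {U c : ℕ} (hU : ∀ i, (univ.filter fun x => cls x = i).card = U)
    (hS : ∀ i, (univ.filter fun x => cls x = i ∧ x ∉ S).card = c) (b : Fin (t + 1)) :
    t * (k * c + U) ≤ classSize (netColor (k := k) cls S) (b, none) := by
  classical
  rw [classSize_prod, Fintype.sum_prod_type]
  let g : ℕ → ℕ := fun l => if l < k then c else U
  have hg : ∀ i l, (univ.filter fun x => cls x = i ∧ (l < k → x ∉ S)).card = g l := by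
    intro i l
    by_cases hl : l < k
    · simp [hl, g, hS]
    · simp [hl, g, hU]
  have hgsum : ∑ l ∈ range (k + 1), g l = k * c + U := by
    rw [Finset.sum_range_succ, Finset.sum_congr rfl (g := fun _ => c)]
    · simp [g]
    · intro l hl
      simp [g, Finset.mem_range.1 hl]
  have hj : ∀ j : Fin t, k * c + U ≤ ∑ o, (univ.filter fun x =>
      netColor (k := k) cls S ((j, o), x) = (b, none)).card := by
    intro j
    rw [← hgsum, Finset.sum_range_succ', Fintype.sum_option, add_comm, Fintype.sum_prod_type]
    refine Nat.add_le_add ?_ ?_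
    · rw [← hg b 0]
      refine Finset.card_le_card fun x => ?_
      simp only [mem_filter, mem_univ, true_and, netColor_root, poolColor_eq_none]
      exact id
    · rw [← Fin.sum_univ_eq_sum_range (fun l => g (l + 1))]
      refine le_trans (Finset.sum_le_sum fun l _ => ?_) (Finset.single_le_sum
        (f := fun b' : Fin (t + 1) => ∑ l : Fin k, (univ.filter fun x =>
          netColor (k := k) cls S ((j, some (b', l)), x) = (b, none)).card)
        (fun _ _ => Nat.zero_le _) (mem_univ b))
      rw [← hg (Fin.last t) (l + 1)]
      refine Finset.card_le_card fun x => ?_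
      simp only [mem_filter, mem_univ, true_and]
      rintro ⟨h1, h2⟩
      rw [netColor_last h1, poolColor_eq_none]
      exact ⟨rfl, h2⟩
  simpa using Finset.card_nsmul_le_sum univ _ _ fun j _ => hj j

end netColor

/-- A set meeting every fiber of `f` in a prescribed number of points. -/
theorem exists_finset_card_fiber_eq {X β : Type} [Fintype X] [DecidableEq X] [Fintype β]
    [DecidableEq β] (f : X → β) {m : ℕ} (h : ∀ i, m ≤ (univ.filter fun x => f x = i).card) :
    ∃ S : Finset X, ∀ i, (univ.filter fun x => f x = i ∧ x ∈ S).card = m := by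
  choose T hT hTm using fun i => Finset.exists_subset_card_eq (h i)
  refine ⟨univ.filter fun x => x ∈ T (f x), fun i => ?_⟩
  rw [← hTm i]
  congr 1
  ext x
  simp only [mem_filter, mem_univ, true_and]
  constructor
  · rintro ⟨rfl, hx⟩
    exact hx
  · intro hx
    have hfx : f x = i := by simpa using hT i hx
    exact ⟨hfx, hfx ▸ hx⟩

theorem exists_eq_succ_mul_of_mod_eq {n t : ℕ} (ht : 1 ≤ t) (hn : 0 < n)
    (h : n % ((t + 1) * t) = (t + 1) % ((t + 1) * t)) :
    ∃ k, n = (t + 1) * (k * t + 1) := by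
  have hle : t + 1 ≤ n := by
    rcases ht.eq_or_lt with rfl | ht
    · omega
    · rw [Nat.mod_eq_of_lt (show t + 1 < (t + 1) * t by nlinarith)] at h
      exact h ▸ Nat.mod_le _ _
  obtain ⟨k, hk⟩ := (Nat.modEq_iff_dvd' hle).1 (show t + 1 ≡ n [MOD (t + 1) * t] from h.symm)
  refine ⟨k, ?_⟩
  rw [← Nat.sub_add_cancel hle, hk]
  ring

theorem exists_ceil_div {U q : ℕ} (hU : 0 < U) (hq : 0 < q) :
    ∃ c, U ≤ q * c ∧ c ≤ U ∧ q * c < U + q := by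
  refine ⟨(U - 1) / q + 1, ?_, ?_, ?_⟩
  · have := Nat.lt_mul_div_succ (U - 1) hq
    omega
  · have := Nat.div_le_self (U - 1) q
    omega
  · have := Nat.mul_div_le (U - 1) q
    rw [mul_add]
    omega

theorem floor_add_ceil_le {s q U c : ℕ} (hq : 0 < q) (hs : 0 < s) (hc : q * c < U + q) :
    (s * q - 1) * U / q + c ≤ s * U := by
  have h1 := Nat.mul_div_le ((s * q - 1) * U) q
  have h2 : (s * q - 1) * U + U = q * (s * U) := by
    have : 1 ≤ s * q := Nat.mul_pos hs hq
    rw [← Nat.succ_mul, Nat.succ_eq_add_one, Nat.sub_add_cancel this]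
    ring
  have h3 : q * ((s * q - 1) * U / q + c) < q * (s * U + 1) := by
    rw [mul_add, mul_add]
    omega
  exact Nat.lt_succ_iff.1 (Nat.lt_of_mul_lt_mul_left h3)

theorem card_filter_fst_eq {A : Type} [Fintype A] {d : ℕ} (P : A → Prop)
    [DecidablePred P] :
    (univ.filter fun x : A × Fin d => P x.1).card = (univ.filter P).card * d := by
  have : (univ.filter fun x : A × Fin d => P x.1) = univ.filter P ×ˢ univ := by
    ext x
    simp
  simp [this]

/-- If an `(r, s)`-net exists, `s ∣ Δ`, `Δ ≥ s`, and `n ≡ s (mod s(s-1))`, then there is an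
edge-colored `r`-graph with maximum degree `Δ` and `n` color classes, each of size at least
`⌊(n-1)rΔ/n⌋`, with no full rainbow matching. -/
theorem stmt15 (r s Δ n : ℕ) (hr : 1 ≤ r) (hs : 2 ≤ s) (hnet : IsNet r s)
    (hΔpos : 0 < Δ) (hnpos : 0 < n)
    (hΔmod : Δ % s = 0) (hΔge : s ≤ Δ)
    (hnmod : n % (s * (s - 1)) = s % (s * (s - 1))) :
    ∃ (N M : ℕ) (E : Fin M → Finset (Fin N)) (c : Fin M → Fin n),
      (∀ a, (E a).card = r) ∧
      (∀ v, mhDeg E v ≤ Δ) ∧ (∃ v, mhDeg E v = Δ) ∧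
      (∀ i : Fin n, (n - 1) * r * Δ / n ≤ classSize c i) ∧
      ¬ hasFullRainbowMatching E c := by

  classical
  obtain ⟨t, rfl⟩ : ∃ t, s = t + 1 := ⟨s - 1, by omega⟩
  have ht : 1 ≤ t := by omega
  obtain ⟨k, rfl⟩ := exists_eq_succ_mul_of_mod_eq ht hnpos (by simpa using hnmod)
  obtain ⟨d, rfl⟩ := Nat.dvd_of_mod_eq_zero hΔmod
  have hd : 0 < d := Nat.pos_of_mul_pos_left hΔpos
  have hU : 0 < r * d := Nat.mul_pos hr hd
  obtain ⟨c, hc1, hc2, hc3⟩ := exists_ceil_div hU (Nat.succ_pos (k * t))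
  obtain ⟨E, p, hEr, hpr, hdisj, hcover, hmeet⟩ := hnet
  let cls : Fin (r * (t + 1)) × Fin d → Fin (t + 1) := fun x => p x.1
  have hclsU : ∀ i, (univ.filter fun x => cls x = i).card = r * d := fun i =>
    (card_filter_fst_eq fun a => p a = i).trans (by rw [hpr])
  obtain ⟨S, hS⟩ := exists_finset_card_fiber_eq cls (m := r * d - c)
    fun i => (hclsU i).symm ▸ Nat.sub_le _ _
  have hS' : ∀ i, (univ.filter fun x => cls x = i ∧ x ∉ S).card = c := fun i => by
    have := Finset.card_filter_add_card_filter_not (s := univ.filter fun x => cls x = i) (· ∈ S)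
    rw [Finset.filter_filter, Finset.filter_filter, hS, hclsU] at this
    omega
  let F : (Fin t × Option (Fin (t + 1) × Fin k)) × (Fin (r * (t + 1)) × Fin d) →
      Finset ((Fin t × Option (Fin (t + 1) × Fin k)) × Fin (r * r)) :=
    fun e => {e.1} ×ˢ E e.2.1
  refine exists_fin_model (κ := Fin (t + 1) × Option (Fin k × Fin t)) (by simp) F
    (netColor cls S) (fun a => by simp [F, hEr]) ?_
    ((⟨0, ht⟩, none), ⟨0, Nat.mul_pos hr hr⟩) ?_ ?_
  · rintro ⟨ν, v⟩
    have hv : (univ.filter fun a => v ∈ E a).card = t + 1 := by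
      refine Eq.trans ?_ (Finset.card_fin (t + 1))
      refine Finset.card_bij (fun a _ => p a) (fun _ _ => mem_univ _) ?_ ?_
      · intro a ha b hb hab
        by_contra hne
        exact Finset.disjoint_left.1 (hdisj a b hne hab) (by simpa using ha) (by simpa using hb)
      · intro i _
        obtain ⟨a, hai, hva⟩ := hcover i v
        exact ⟨a, by simpa using hva, hai⟩
    have : (univ.filter fun e => (ν, v) ∈ F e) =
        {ν} ×ˢ (univ.filter fun x : _ × Fin d => v ∈ E x.1) := by
      ext e
      simp only [F, mem_filter, mem_univ, true_and, Finset.mem_product, Finset.mem_singleton,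
        eq_comm]
    rw [mhDeg, this, Finset.card_product, card_filter_fst_eq fun a => v ∈ E a, hv]
    simp
  · have hfloor : ((t + 1) * (k * t + 1) - 1) * r * ((t + 1) * d) / ((t + 1) * (k * t + 1)) + c ≤
        (t + 1) * (r * d) := by
      have := floor_add_ceil_le (s := t + 1) (Nat.succ_pos (k * t)) (Nat.succ_pos t) hc3
      rw [show ((t + 1) * (k * t + 1) - 1) * r * ((t + 1) * d) =
        (t + 1) * (((t + 1) * (k * t + 1) - 1) * (r * d)) by ring,
        Nat.mul_div_mul_left _ _ (Nat.succ_pos t)]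
      exact this
    rw [Nat.succ_mul t (r * d)] at hfloor
    rintro ⟨b, _ | ⟨l, i⟩⟩
    · refine le_trans ?_ (le_classSize_none hclsU hS' b)
      have : t * (k * c + r * d) + c = t * (r * d) + (k * t + 1) * c := by ring
      simp only [Nat.succ_eq_add_one] at hc1
      omega
    · refine le_trans ?_ (le_classSize_some hclsU hS b l i)
      omega
  · rintro ⟨f, hfc, hfd⟩
    refine netColor_no_transversal f hfc fun y z hyz => ?_
    by_contra hne
    have hyz' : y ≠ z := by
      rintro rfl
      exact hne rfl
    have hcard := hmeet _ _ hne
    obtain ⟨v, hv⟩ := Finset.card_pos.1 (hcard ▸ Nat.one_pos)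
    rw [Finset.mem_inter] at hv
    refine Finset.disjoint_left.1 (hfd y z hyz') (?_ : ((f y).1, v) ∈ F (f y)) ?_
    · simpa [F] using hv.1
    · simpa [F, hyz] using hv.2
end
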